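/- arXiv:math/0605280 — 12 statements merged into one kernel-verified Lean document; each statement's English description precedes it below -/
import Mathlib

section
/- For every type X, every commutative ring R with unit, and every function r : X → R, there exists a map τ : Finset X → Finset X → R such that: (i) τ {x} {x} = r x for all x ∈ X; (ii) τ {x} {y} = − τ {y} {x} for all x, y ∈ X with x ≠ y; (iii) τ ∅ A = 1 and τ A ∅ = 1 for every finite subset A; (iv) τ A B * τ (A Δ B) C = τ A (B Δ C) * τ B C for all finite subsets A, B, C; and (v) whenever A ∩ B = ∅, either τ A B = 1 or τ A B = −1. -/
open scoped symmDiff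

/-- A product of square roots of one is multiplicative under symmetric difference. -/
theorem Finset.prod_symmDiff_of_mul_self_eq_one {X R : Type*} [DecidableEq X] [CommMonoid R]
    (f : X → R) (hf : ∀ x, f x * f x = 1) (A B : Finset X) :
    ∏ x ∈ symmDiff A B, f x = (∏ x ∈ A, f x) * ∏ x ∈ B, f x := by
  have hd : Disjoint (A \ B) (B \ A) := disjoint_sdiff_sdiff
  have h : symmDiff A B = A \ B ∪ B \ A := rfl
  have hsq : (∏ x ∈ A ∩ B, f x) * ∏ x ∈ B ∩ A, f x = 1 := by
    rw [Finset.inter_comm B A, ← Finset.prod_mul_distrib]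
    exact Finset.prod_eq_one fun x _ => hf x
  rw [h, Finset.prod_union hd, ← Finset.prod_inter_mul_prod_sdiff A B f,
    ← Finset.prod_inter_mul_prod_sdiff B A f, mul_mul_mul_comm, hsq, one_mul]

/-- The product of `r` over pairwise intersections is a cocycle for symmetric difference. -/
theorem Finset.prod_inter_mul_prod_symmDiff_inter {X R : Type*} [DecidableEq X] [CommMonoid R]
    (r : X → R) (A B C : Finset X) :
    (∏ x ∈ A ∩ B, r x) * ∏ x ∈ symmDiff A B ∩ C, r x =
      (∏ x ∈ A ∩ symmDiff B C, r x) * ∏ x ∈ B ∩ C, r x := by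
  rw [← Finset.prod_union, ← Finset.prod_union]
  · congr 1
    ext x
    simp only [Finset.mem_union, Finset.mem_inter, Finset.mem_symmDiff]
    tauto
  · rw [Finset.disjoint_left]
    simp only [Finset.mem_inter, Finset.mem_symmDiff]
    tauto
  · rw [Finset.disjoint_left]
    simp only [Finset.mem_inter, Finset.mem_symmDiff]
    tauto

/-- A finite product of signs is a sign. -/
theorem Finset.prod_eq_one_or_neg_one {X R : Type*} [CommRing R] (f : X → R)
    (hf : ∀ x, f x = 1 ∨ f x = -1) (A : Finset X) :
    ∏ x ∈ A, f x = 1 ∨ ∏ x ∈ A, f x = -1 := by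
  refine Finset.prod_induction f (fun y => y = 1 ∨ y = -1) ?_ (Or.inl rfl) fun x _ => hf x
  rintro a b (rfl | rfl) (rfl | rfl) <;> simp

/-- **Existence of a grassmannian (twisting) map.**
For every type `X`, commutative ring `R` with unit, and signature `r : X → R`, there is a
map `τ` on pairs of finite subsets of `X` satisfying the five defining properties of a
grassmannian map (the twisting map of the combinatorial Clifford algebra `Cl(X,R,r)`). -/
theorem exists_grassmannian_map (X : Type*) [DecidableEq X] (R : Type*) [CommRing R]
    (r : X → R) :
    ∃ τ : Finset X → Finset X → R,
      (∀ x : X, τ {x} {x} = r x) ∧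
      (∀ x y : X, x ≠ y → τ {x} {y} = - τ {y} {x}) ∧
      (∀ A : Finset X, τ ∅ A = 1 ∧ τ A ∅ = 1) ∧
      (∀ A B C : Finset X, τ A B * τ (symmDiff A B) C = τ A (symmDiff B C) * τ B C) ∧
      (∀ A B : Finset X, A ∩ B = ∅ → τ A B = 1 ∨ τ A B = -1) := by
  classical
  let s : X → X → R := fun a b => if WellOrderingRel b a then -1 else 1
  have hs : ∀ a b, s a b = 1 ∨ s a b = -1 := fun a b => by
    by_cases h : WellOrderingRel b a <;> simp [s, h]
  have hsq : ∀ a b, s a b * s a b = 1 := fun a b => by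
    rcases hs a b with h | h <;> simp [h]
  have hself : ∀ a, s a a = 1 := fun a => if_neg (irrefl a)
  have hanti : ∀ a b, a ≠ b → s a b = -s b a := fun a b hab => by
    rcases trichotomous_of WellOrderingRel a b with h | h | h
    · have h' : ¬WellOrderingRel b a := asymm h
      simp [s, h, h']
    · exact absurd h hab
    · have h' : ¬WellOrderingRel a b := asymm h
      simp [s, h, h']
  refine ⟨fun A B => (∏ a ∈ A, ∏ b ∈ B, s a b) * ∏ x ∈ A ∩ B, r x, ?_, ?_, ?_, ?_, ?_⟩
  · intro x
    simp [hself]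
  · intro x y hxy
    have h₁ : ({x} : Finset X) ∩ {y} = ∅ := by simp [hxy]
    have h₂ : ({y} : Finset X) ∩ {x} = ∅ := by simp [hxy.symm]
    simp [h₁, h₂, hanti x y hxy]
  · intro A
    simp
  · intro A B C
    have hleft : ∏ a ∈ symmDiff A B, ∏ c ∈ C, s a c =
        (∏ a ∈ A, ∏ c ∈ C, s a c) * ∏ b ∈ B, ∏ c ∈ C, s b c :=
      Finset.prod_symmDiff_of_mul_self_eq_one _ (fun a => by
        rw [← Finset.prod_mul_distrib]
        exact Finset.prod_eq_one fun c _ => hsq a c) A B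
    have hright : ∏ a ∈ A, ∏ b ∈ symmDiff B C, s a b =
        (∏ a ∈ A, ∏ b ∈ B, s a b) * ∏ a ∈ A, ∏ c ∈ C, s a c := by
      rw [← Finset.prod_mul_distrib]
      exact Finset.prod_congr rfl fun a _ =>
        Finset.prod_symmDiff_of_mul_self_eq_one _ (hsq a) B C
    beta_reduce
    rw [hleft, hright, mul_mul_mul_comm, Finset.prod_inter_mul_prod_symmDiff_inter]
    ring
  · intro A B hAB
    beta_reduce
    rw [hAB, Finset.prod_empty, mul_one]
    exact Finset.prod_eq_one_or_neg_one _
      (fun a => Finset.prod_eq_one_or_neg_one _ (hs a) B) A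
end

section
/- For every type X there exists a function μ : Set (Set X) → ZMod 2 such that: (i) for every finite collection 𝒜 of subsets of X, μ(𝒜) equals the cardinality of 𝒜 modulo 2; and (ii) μ(𝒜 ∪ ℬ) = μ(𝒜) + μ(ℬ) whenever 𝒜 and ℬ are disjoint collections of subsets of X. -/
/-- The sum of the values of a finitely supported function extends to a linear functional on all
functions. -/
theorem exists_linearMap_extending_finsupp_sum (K Y : Type*) [Field K] :
    ∃ φ : (Y → K) →ₗ[K] K, ∀ f : Y →₀ K, φ f = f.sum fun _ a => a := by
  obtain ⟨g, hg⟩ := (Finsupp.lcoeFun : (Y →₀ K) →ₗ[K] Y → K).exists_leftInverse_of_injective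
    (LinearMap.ker_eq_bot.2 DFunLike.coe_injective)
  refine ⟨(Finsupp.linearCombination K fun _ => (1 : K)) ∘ₗ g, fun f => ?_⟩
  have hgf : g f = f := LinearMap.congr_fun hg f
  simp [hgf, Finsupp.linearCombination_apply]

/-- **Finitely additive mod-2 cardinality on families of subsets.**
For every type `X` there is a `ZMod 2`-valued function `μ` on collections of subsets of `X`
which agrees with cardinality modulo 2 on finite collections and is additive on disjoint
collections. -/
theorem exists_mod_two_cardinality (X : Type*) :
    ∃ μ : Set (Set X) → ZMod 2,
      (∀ 𝒜 : Set (Set X), 𝒜.Finite → μ 𝒜 = (𝒜.ncard : ZMod 2)) ∧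
      (∀ 𝒜 ℬ : Set (Set X), Disjoint 𝒜 ℬ → μ (𝒜 ∪ ℬ) = μ 𝒜 + μ ℬ) := by
  classical
  obtain ⟨φ, hφ⟩ := exists_linearMap_extending_finsupp_sum (ZMod 2) (Set X)
  refine ⟨fun 𝒜 => φ (𝒜.indicator 1), fun 𝒜 h𝒜 => ?_, fun 𝒜 ℬ h => ?_⟩
  · lift 𝒜 to Finset (Set X) using h𝒜
    have hind : (𝒜 : Set (Set X)).indicator (1 : Set X → ZMod 2) =
        ⇑(Finsupp.indicator 𝒜 fun _ _ => (1 : ZMod 2)) := by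
      ext A
      simp [Set.indicator_apply, Finsupp.indicator_apply]
    simp only [hind, hφ, Set.ncard_coe_finset]
    rw [Finsupp.sum_of_support_subset _ (Finsupp.support_indicator_subset ..) _ fun _ _ => rfl]
    simp +contextual [Finsupp.indicator_apply]
  · simp only [Set.indicator_union_of_disjoint h, ← map_add]
    rfl
end

section
/- Let R be a nontrivial commutative ring, let m ≤ n be natural numbers, and let x : Fin m → (Fin n → R) be an m-tuple of vectors in the free module R^n. Then the family (x i) is linearly independent over R if and only if the m-fold wedge x 0 ∧ x 1 ∧ ⋯ ∧ x (m−1) in the exterior algebra of R^n is linearly independent, i.e., if and only if every r ∈ R with r • (x 0 ∧ ⋯ ∧ x (m−1)) = 0 satisfies r = 0. -/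
/-- A relation `∑ i, c i • x i = 0` forces each coefficient to annihilate the value of every
alternating map at `x`. -/
theorem AlternatingMap.smul_map_eq_zero_of_sum_smul_eq_zero {R M N ι : Type*} [CommRing R]
    [AddCommGroup M] [Module R M] [AddCommGroup N] [Module R N] [Fintype ι]
    (g : M [⋀^ι]→ₗ[R] N) {x : ι → M} {c : ι → R} (h : ∑ j, c j • x j = 0) (i : ι) :
    c i • g x = 0 := by
  classical
  have h0 : g (Function.update x i (∑ j, c j • x j)) = 0 := by
    rw [h]
    exact g.map_update_zero x i
  rw [g.map_update_sum, Finset.sum_eq_single i] at h0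
  · simpa [g.map_update_smul] using h0
  · intro j _ hj
    rw [g.map_update_smul, g.map_update_self x hj.symm, smul_zero]
  · simp

/-- If a scalar annihilates all maximal minors of a matrix with linearly independent rows, then it
is zero. -/
theorem LinearIndependent.eq_zero_of_forall_mul_det_submatrix_eq_zero {R κ : Type*} [CommRing R]
    {m : ℕ} {x : Fin m → κ → R} (hx : LinearIndependent R x) {r : R}
    (h : ∀ f : Fin m → κ, r * ((Matrix.of x).submatrix id f).det = 0) : r = 0 := by
  induction m with
  | zero => simpa using h Fin.elim0
  | succ m ih =>
    refine ih (x := fun i => x i.succ) (hx.comp _ (Fin.succ_injective m)) fun f => ?_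
    have hrel : ∑ i : Fin (m + 1),
        (r * ((-1) ^ (i : ℕ) * ((Matrix.of x).submatrix i.succAbove f).det)) • x i = 0 := by
      ext k
      have hk := h (Fin.cons k f)
      rw [Matrix.det_succ_column_zero, Finset.mul_sum] at hk
      rw [Finset.sum_apply, Pi.zero_apply, ← hk]
      refine Finset.sum_congr rfl fun i _ => ?_
      have hsub : ((Matrix.of x).submatrix id (Fin.cons k f)).submatrix i.succAbove Fin.succ =
          (Matrix.of x).submatrix i.succAbove f := by
        ext; simp
      rw [hsub]
      simp only [Pi.smul_apply, smul_eq_mul, Matrix.submatrix_apply, Matrix.of_apply, id,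
        Fin.cons_zero]
      ring
    have h0 := Fintype.linearIndependent_iff.mp hx _ hrel 0
    rw [Fin.val_zero, pow_zero, one_mul] at h0
    exact h0

/-- A scalar annihilating a blade in `κ → R` annihilates every maximal minor of the matrix whose
rows are the factors of the blade. -/
theorem ExteriorAlgebra.mul_det_submatrix_eq_zero_of_smul_ιMulti_eq_zero {R κ : Type*}
    [CommRing R] {m : ℕ} {x : Fin m → κ → R} {r : R}
    (h : r • ExteriorAlgebra.ιMulti R m x = 0) (f : Fin m → κ) :
    r * ((Matrix.of x).submatrix id f).det = 0 := by
  have h' := congrArg (ExteriorAlgebra.liftAlternating (R := R) (Pi.single m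
    (Matrix.detRowAlternating.compLinearMap (LinearMap.funLeft R R f)))) h
  rw [map_smul, ExteriorAlgebra.liftAlternating_apply_ιMulti, map_zero, Pi.single_eq_same] at h'
  exact h'

/-- **Linear independence of vectors versus their outer product.**
Over a nontrivial commutative ring `R`, an `m`-tuple of vectors `x` in `R^n` (with `m ≤ n`)
is linearly independent if and only if the `m`-blade `x 0 ∧ ⋯ ∧ x (m-1)` in the exterior
algebra of `R^n` is linearly independent (i.e. `r • (x 0 ∧ ⋯ ∧ x (m-1)) = 0` forces
`r = 0`). -/
theorem linearIndependent_iff_ιMulti_linearIndependent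
    (R : Type*) [CommRing R] [Nontrivial R] (n m : ℕ) (hmn : m ≤ n)
    (x : Fin m → (Fin n → R)) :
    LinearIndependent R x ↔
      ∀ r : R, r • ExteriorAlgebra.ιMulti R m x = 0 → r = 0 := by
  refine ⟨fun hx r hr => hx.eq_zero_of_forall_mul_det_submatrix_eq_zero
    (ExteriorAlgebra.mul_det_submatrix_eq_zero_of_smul_ιMulti_eq_zero hr), fun h => ?_⟩
  exact Fintype.linearIndependent_iff.mpr fun c hc i =>
    h (c i) ((ExteriorAlgebra.ιMulti R m).smul_map_eq_zero_of_sum_smul_eq_zero hc i)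
end

section
/- For all natural numbers s and t: G(s+1, t) is isomorphic as an ℝ-algebra to G(t+1, s), and the even subalgebra G⁺(s, t) is isomorphic as an ℝ-algebra to the even subalgebra G⁺(t, s). -/
/-- The quadratic form of signature `(s, t)` on `ℝ^(s+t)`:
`Q x = Σ_{i < s} x i ^ 2 - Σ_{s ≤ i < s+t} x i ^ 2`. -/
noncomputable def Qst (s t : ℕ) : QuadraticForm ℝ (Fin (s + t) → ℝ) :=
  QuadraticMap.weightedSumSquares ℝ
    (fun i : Fin (s + t) => if (i : ℕ) < s then (1 : ℝ) else -1)

namespace CliffordAlgebra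

variable {R M N : Type*} [CommRing R] [AddCommGroup M] [Module R M] [AddCommGroup N] [Module R N]

section Even

variable {Q : QuadraticForm R M} {Q' : QuadraticForm R N}

/-- The algebra morphism between even subalgebras induced by an isometry. -/
def evenMap (f : Q →qᵢ Q') : even Q →ₐ[R] even Q' :=
  even.lift Q
    { bilin := (even.ι Q').bilin.compl₁₂ f.toLinearMap f.toLinearMap
      contract := fun m => by
        simp [EvenHom.contract]
      contract_mid := fun m₁ m₂ m₃ => by
        simp [EvenHom.contract_mid] }

theorem evenMap_ι (f : Q →qᵢ Q') (m₁ m₂ : M) :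
    evenMap f ((even.ι Q).bilin m₁ m₂) = (even.ι Q').bilin (f m₁) (f m₂) :=
  even.lift_ι _ _ m₁ m₂

/-- Isometric quadratic forms have isomorphic even Clifford algebras. -/
def evenEquivOfIsometry (e : Q.IsometryEquiv Q') : even Q ≃ₐ[R] even Q' :=
  AlgEquiv.ofAlgHom (evenMap e.toIsometry) (evenMap e.symm.toIsometry)
    (by
      ext m₁ m₂ : 4
      simp [evenMap_ι])
    (by
      ext m₁ m₂ : 4
      simp [evenMap_ι])

end Even

section ProdSq

variable (Q : QuadraticForm R M)

/-- The unit vector of square `1` in the Clifford algebra of `Q ⊕ ⟨1⟩`. -/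
def unitVec : CliffordAlgebra (Q.prod (QuadraticMap.sq (R := R))) :=
  ι _ (0, 1)

/-- The inclusion of `M` into the Clifford algebra of `Q ⊕ ⟨1⟩`. -/
def vec : M →ₗ[R] CliffordAlgebra (Q.prod (QuadraticMap.sq (R := R))) :=
  ι _ ∘ₗ LinearMap.inl R M R

theorem unitVec_mul_self : unitVec Q * unitVec Q = 1 :=
  (ι_sq_scalar _ _).trans <| by simp

theorem vec_mul_self (m : M) : vec Q m * vec Q m = algebraMap R _ (Q m) :=
  (ι_sq_scalar _ _).trans <| by simp

theorem unitVec_mul_vec (m : M) : unitVec Q * vec Q m = -(vec Q m * unitVec Q) := by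
  refine eq_neg_of_add_eq_zero_left ((ι_mul_ι_add_swap _ _).trans ?_)
  simp [QuadraticMap.polar]

/-- The morphism sending the unit vector `e` to itself and `v : M` to `v * e`. -/
def prodSqToNeg (Q' : QuadraticForm R M) (h : Q' = -Q) :
    CliffordAlgebra (Q.prod (QuadraticMap.sq (R := R))) →ₐ[R]
      CliffordAlgebra (Q'.prod (QuadraticMap.sq (R := R))) :=
  lift _ ⟨((LinearMap.mulRight R (unitVec Q')).comp (vec Q')).coprod
      (LinearMap.toSpanSingleton R _ (unitVec Q')), by
    rintro ⟨m, r⟩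
    have h₁ : vec Q' m * unitVec Q' * (vec Q' m * unitVec Q') = algebraMap R _ (Q m) := by
      rw [mul_assoc, ← mul_assoc (unitVec Q'), unitVec_mul_vec, neg_mul, mul_assoc,
        unitVec_mul_self, mul_one, mul_neg, vec_mul_self, h]
      simp
    have h₂ : vec Q' m * unitVec Q' * unitVec Q' = vec Q' m := by
      rw [mul_assoc, unitVec_mul_self, mul_one]
    have h₃ : unitVec Q' * (vec Q' m * unitVec Q') = -vec Q' m := by
      rw [← mul_assoc, unitVec_mul_vec, neg_mul, h₂]
    simp only [LinearMap.coprod_apply, LinearMap.comp_apply, LinearMap.mulRight_apply,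
      LinearMap.toSpanSingleton_apply, mul_add, add_mul, h₁, mul_smul_comm, smul_mul_assoc, h₂, h₃,
      unitVec_mul_self, QuadraticMap.prod_apply, QuadraticMap.sq_apply, map_add, map_mul,
      Algebra.algebraMap_eq_smul_one, smul_neg]
    simp⟩

theorem prodSqToNeg_vec (Q' : QuadraticForm R M) (h : Q' = -Q) (m : M) :
    prodSqToNeg Q Q' h (vec Q m) = vec Q' m * unitVec Q' := by
  simp [prodSqToNeg, vec]

theorem prodSqToNeg_unitVec (Q' : QuadraticForm R M) (h : Q' = -Q) :
    prodSqToNeg Q Q' h (unitVec Q) = unitVec Q' := by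
  simp [prodSqToNeg, unitVec]

theorem prodSqToNeg_comp_prodSqToNeg (Q' : QuadraticForm R M) (h : Q' = -Q) (h' : Q = -Q') :
    (prodSqToNeg Q' Q h').comp (prodSqToNeg Q Q' h) = AlgHom.id R _ := by
  refine hom_ext (LinearMap.prod_ext (LinearMap.ext fun m => ?_) (LinearMap.ext_ring ?_))
  · change prodSqToNeg Q' Q h' (prodSqToNeg Q Q' h (vec Q m)) = vec Q m
    rw [prodSqToNeg_vec, map_mul, prodSqToNeg_vec, prodSqToNeg_unitVec, mul_assoc,
      unitVec_mul_self, mul_one]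
  · change prodSqToNeg Q' Q h' (prodSqToNeg Q Q' h (unitVec Q)) = unitVec Q
    rw [prodSqToNeg_unitVec, prodSqToNeg_unitVec]

/-- The Clifford algebras of `Q ⊕ ⟨1⟩` and `-Q ⊕ ⟨1⟩` are isomorphic. -/
def prodSqEquivNeg :
    CliffordAlgebra (Q.prod (QuadraticMap.sq (R := R))) ≃ₐ[R]
      CliffordAlgebra ((-Q).prod (QuadraticMap.sq (R := R))) :=
  AlgEquiv.ofAlgHom (prodSqToNeg Q _ rfl) (prodSqToNeg (-Q) _ (neg_neg _).symm)
    (prodSqToNeg_comp_prodSqToNeg _ _ _ _) (prodSqToNeg_comp_prodSqToNeg _ _ _ _)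

end ProdSq

end CliffordAlgebra

/-- Reversing the order of the coordinates is an isometry from `-Q(s, t)` to `Q(t, s)`. -/
noncomputable def negQstIsometryEquiv (s t : ℕ) : (-Qst s t).IsometryEquiv (Qst t s) where
  toLinearEquiv :=
    LinearEquiv.funCongrLeft ℝ ℝ ((finCongr (Nat.add_comm t s)).trans Fin.revPerm)
  map_app' x := by
    simp only [Qst, neg_apply, QuadraticMap.weightedSumSquares_apply,
      ← Finset.sum_neg_distrib]
    refine Fintype.sum_equiv ((finCongr (Nat.add_comm t s)).trans Fin.revPerm) _ _ fun i => ?_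
    have h : s + t - (i + 1) < s ↔ ¬ (i : ℕ) < t := by omega
    by_cases hi : (i : ℕ) < t <;> simp [LinearMap.funLeft_apply, h, hi]

/-- Prepending a coordinate is an isometry from `Q(s, t) ⊕ ⟨1⟩` to `Q(s + 1, t)`. -/
noncomputable def qstProdSqIsometryEquiv (s t : ℕ) :
    ((Qst s t).prod (QuadraticMap.sq (R := ℝ))).IsometryEquiv (Qst (s + 1) t) where
  toLinearEquiv :=
    (LinearEquiv.prodComm ℝ _ _).trans <| (Fin.consLinearEquiv ℝ fun _ => ℝ).trans <|
      LinearEquiv.funCongrLeft ℝ ℝ (finCongr (Nat.add_right_comm s 1 t))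
  map_app' := by
    rintro ⟨x, r⟩
    simp only [Qst, QuadraticMap.prod_apply, QuadraticMap.weightedSumSquares_apply,
      QuadraticMap.sq_apply]
    rw [Fintype.sum_equiv (finCongr (Nat.add_right_comm s 1 t)) _
      (fun i : Fin (s + t + 1) => (if (i : ℕ) < s + 1 then (1 : ℝ) else -1) •
        (Fin.cons r x : Fin (s + t + 1) → ℝ) i * (Fin.cons r x : Fin (s + t + 1) → ℝ) i)]
    · simp [Fin.sum_univ_succ, add_comm]
    · intro i
      simp [LinearMap.funLeft_apply]

/-- **Signature-swap isomorphisms:** `G(s+1, t) ≅ G(t+1, s)` and `G⁺(s, t) ≅ G⁺(t, s)`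
as ℝ-algebras. -/
theorem signature_swap_iso (s t : ℕ) :
    Nonempty (CliffordAlgebra (Qst (s + 1) t) ≃ₐ[ℝ] CliffordAlgebra (Qst (t + 1) s)) ∧
    Nonempty ((CliffordAlgebra.even (Qst s t)) ≃ₐ[ℝ] (CliffordAlgebra.even (Qst t s))) := by
  have e := (negQstIsometryEquiv s t).prod (.refl (QuadraticMap.sq (R := ℝ)))
  refine ⟨⟨?_⟩, ⟨?_⟩⟩
  · exact (CliffordAlgebra.equivOfIsometry (qstProdSqIsometryEquiv s t).symm).trans <|
      (CliffordAlgebra.prodSqEquivNeg (Qst s t)).trans <|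
        CliffordAlgebra.equivOfIsometry (e.trans (qstProdSqIsometryEquiv t s))
  · exact (CliffordAlgebra.evenEquivEvenNeg (Qst s t)).trans <|
      CliffordAlgebra.evenEquivOfIsometry (negQstIsometryEquiv s t)
end

section
/- For all natural numbers n, s and t, there are isomorphisms of ℝ-algebras: G(n+2, 0) ≅ G(0, n) ⊗[ℝ] G(2, 0); G(0, n+2) ≅ G(n, 0) ⊗[ℝ] G(0, 2); and G(s+1, t+1) ≅ G(s, t) ⊗[ℝ] G(1, 1). -/
open scoped TensorProduct

namespace CliffordAlgebra

variable {R M₁ M₂ : Type*} [CommRing R] [AddCommGroup M₁] [AddCommGroup M₂]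
  [Module R M₁] [Module R M₂]

section Twisted

variable (Q₁ : QuadraticForm R M₁) (Q₂ : QuadraticForm R M₂) (c : Rˣ) (ω : CliffordAlgebra Q₂)

/-- The map out of `CliffordAlgebra (((c : R) • Q₁).prod Q₂)` sending `(x, y)` to
`ι x ⊗ ω + 1 ⊗ ι y`, for an element `ω` with `ω ^ 2 = c` anticommuting with all vectors. -/
noncomputable def toTwistedTensor (hω : ω * ω = algebraMap R _ (c : R))
    (hanti : ∀ v, ω * ι Q₂ v = -(ι Q₂ v * ω)) :
    CliffordAlgebra (((c : R) • Q₁).prod Q₂) →ₐ[R] CliffordAlgebra Q₁ ⊗[R] CliffordAlgebra Q₂ :=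
  lift _ ⟨LinearMap.coprod ((TensorProduct.mk R _ _).flip ω ∘ₗ ι Q₁)
      (TensorProduct.mk R _ _ 1 ∘ₗ ι Q₂), fun m => by
    simp only [LinearMap.coprod_apply, LinearMap.comp_apply, LinearMap.flip_apply,
      TensorProduct.mk_apply, add_mul, mul_add, Algebra.TensorProduct.tmul_mul_tmul, ι_sq_scalar,
      one_mul, mul_one, hω, hanti, QuadraticMap.prod_apply, smul_apply, smul_eq_mul,
      map_add, TensorProduct.tmul_neg, Algebra.algebraMap_eq_smul_one, TensorProduct.smul_tmul',
      TensorProduct.tmul_smul, smul_smul, Algebra.TensorProduct.one_def]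
    abel⟩

variable {Q₁ Q₂ c ω}

theorem toTwistedTensor_ι (hω : ω * ω = algebraMap R _ (c : R))
    (hanti : ∀ v, ω * ι Q₂ v = -(ι Q₂ v * ω)) (m : M₁ × M₂) :
    toTwistedTensor Q₁ Q₂ c ω hω hanti (ι _ m) = ι Q₁ m.1 ⊗ₜ ω + 1 ⊗ₜ ι Q₂ m.2 :=
  lift_ι_apply ..

theorem toTwistedTensor_map_inr (hω : ω * ω = algebraMap R _ (c : R))
    (hanti : ∀ v, ω * ι Q₂ v = -(ι Q₂ v * ω)) (x : CliffordAlgebra Q₂) :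
    toTwistedTensor Q₁ Q₂ c ω hω hanti (map (.inr _ _) x) = 1 ⊗ₜ x := by
  have h : (toTwistedTensor Q₁ Q₂ c ω hω hanti).comp (map (.inr _ _)) =
      Algebra.TensorProduct.includeRight := by
    ext m
    simp [toTwistedTensor_ι]
  exact DFunLike.congr_fun h x

theorem commute_ι_inl_map_inr (Q : QuadraticForm R M₁) (heven : ω ∈ evenOdd Q₂ 0) (m : M₁) :
    Commute (ι (Q.prod Q₂) (m, 0)) (map (.inr Q Q₂) ω) := by
  have h := commute_map_mul_map_of_isOrtho_of_mem_evenOdd_zero_right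
    (.inl Q Q₂) (.inr Q Q₂) QuadraticMap.IsOrtho.inl_inr (ι Q m) ω
    (ι_mem_evenOdd_one Q m) heven
  rwa [map_apply_ι] at h

variable (Q₁ Q₂ c ω)

/-- The map out of `CliffordAlgebra Q₁` sending `x` to `c⁻¹ (ι x) ω`, for an even element `ω`
with `ω ^ 2 = c`. -/
noncomputable def twistedInl (hω : ω * ω = algebraMap R _ (c : R)) (heven : ω ∈ evenOdd Q₂ 0) :
    CliffordAlgebra Q₁ →ₐ[R] CliffordAlgebra (((c : R) • Q₁).prod Q₂) :=
  lift _ ⟨(↑c⁻¹ : R) • LinearMap.mulRight R (map (.inr _ _) ω) ∘ₗ ι _ ∘ₗ LinearMap.inl R M₁ M₂,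
    fun m => by
      simp only [LinearMap.smul_apply, LinearMap.comp_apply, LinearMap.inl_apply,
        LinearMap.mulRight_apply]
      rw [smul_mul_smul_comm,
        (commute_ι_inl_map_inr _ heven m).symm.mul_mul_mul_comm, ι_sq_scalar, ← map_mul, hω,
        AlgHom.commutes, ← map_mul, Algebra.smul_def, ← map_mul]
      congr 1
      simp only [QuadraticMap.prod_apply, smul_apply, smul_eq_mul, map_zero, add_zero]
      linear_combination (Q₁ m) * ((↑c⁻¹ : R) * c + 1) * c.inv_mul⟩

variable {Q₁ Q₂ c ω}

theorem twistedInl_ι (hω : ω * ω = algebraMap R _ (c : R)) (heven : ω ∈ evenOdd Q₂ 0) (m : M₁) :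
    twistedInl Q₁ Q₂ c ω hω heven (ι _ m) = (↑c⁻¹ : R) • (ι _ (m, 0) * map (.inr _ _) ω) :=
  lift_ι_apply ..

theorem commute_twistedInl_map_inr (hω : ω * ω = algebraMap R _ (c : R))
    (heven : ω ∈ evenOdd Q₂ 0) (hanti : ∀ v, ω * ι Q₂ v = -(ι Q₂ v * ω))
    (x : CliffordAlgebra Q₁) (y : CliffordAlgebra Q₂) :
    Commute (twistedInl Q₁ Q₂ c ω hω heven x) (map (.inr _ _) y) := by
  induction x using CliffordAlgebra.induction with
  | algebraMap r => rw [AlgHom.commutes]; exact Algebra.commutes r _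
  | add a b ha hb => rw [map_add]; exact ha.add_left hb
  | mul a b ha hb => rw [map_mul]; exact ha.mul_left hb
  | ι m =>
    induction y using CliffordAlgebra.induction with
    | algebraMap r => rw [AlgHom.commutes]; exact (Algebra.commutes r _).symm
    | add a b ha hb => rw [map_add]; exact ha.add_right hb
    | mul a b ha hb => rw [map_mul]; exact ha.mul_right hb
    | ι v =>
      rw [twistedInl_ι]
      refine Commute.smul_left ?_ _
      have h : map (.inr ((c : R) • Q₁) Q₂) ω * ι _ (0, v) =
          -(ι _ (0, v) * map (.inr ((c : R) • Q₁) Q₂) ω) := by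
        simpa using congrArg (map (.inr ((c : R) • Q₁) Q₂)) (hanti v)
      rw [map_apply_ι, QuadraticMap.Isometry.inr_apply, commute_iff_eq, mul_assoc, h, mul_neg,
        ← mul_assoc, ← mul_assoc, ι_mul_ι_comm_of_isOrtho (QuadraticMap.IsOrtho.inl_inr m v), neg_mul,
        neg_neg]

variable (Q₁) in
/-- If an even element `ω` of `CliffordAlgebra Q₂` anticommutes with all vectors and squares to a
unit `c`, then the Clifford algebra of `c Q₁ ⊕ Q₂` is the ungraded tensor product of those of
`Q₁` and `Q₂`. -/
noncomputable def twistedTensorEquiv (hω : ω * ω = algebraMap R _ (c : R))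
    (heven : ω ∈ evenOdd Q₂ 0) (hanti : ∀ v, ω * ι Q₂ v = -(ι Q₂ v * ω)) :
    CliffordAlgebra (((c : R) • Q₁).prod Q₂) ≃ₐ[R] CliffordAlgebra Q₁ ⊗[R] CliffordAlgebra Q₂ :=
  AlgEquiv.ofAlgHom (toTwistedTensor Q₁ Q₂ c ω hω hanti)
    (Algebra.TensorProduct.lift (twistedInl Q₁ Q₂ c ω hω heven) (map (.inr _ _))
      (commute_twistedInl_map_inr hω heven hanti))
    (by
      ext m
      · simp [twistedInl_ι, toTwistedTensor_ι, toTwistedTensor_map_inr, hω,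
          Algebra.algebraMap_eq_smul_one, TensorProduct.tmul_smul, smul_smul]
      · simp [toTwistedTensor_ι])
    (by
      ext m
      · have h : map (.inr ((c : R) • Q₁) Q₂) ω * map (.inr _ _) ω = algebraMap R _ (c : R) := by
          rw [← map_mul, hω, AlgHom.commutes]
        simp [twistedInl_ι, toTwistedTensor_ι, mul_assoc, h, Algebra.algebraMap_eq_smul_one,
          smul_smul]
      · simp [toTwistedTensor_ι])

end Twisted

variable (Q₁ : QuadraticForm R M₁) {Q₂ : QuadraticForm R M₂} {a b : M₂}

theorem ι_mul_ι_mul_self_of_isOrtho (hab : Q₂.IsOrtho a b) :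
    ι Q₂ a * ι Q₂ b * (ι Q₂ a * ι Q₂ b) = algebraMap R _ (-(Q₂ a * Q₂ b)) := by
  rw [mul_assoc, ← mul_assoc (ι Q₂ b), ι_mul_ι_comm_of_isOrtho hab.symm, neg_mul, mul_neg,
    mul_assoc, ι_sq_scalar, ← mul_assoc, ι_sq_scalar, ← map_mul, ← map_neg]

theorem ι_mul_ι_anticomm_of_isOrtho (hab : Q₂.IsOrtho a b) (x y : R) :
    ι Q₂ a * ι Q₂ b * ι Q₂ (x • a + y • b) = -(ι Q₂ (x • a + y • b) * (ι Q₂ a * ι Q₂ b)) := by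
  have h := ι_mul_ι_comm_of_isOrtho hab.symm
  have ha : ι Q₂ a * ι Q₂ b * ι Q₂ a = -(ι Q₂ a * (ι Q₂ a * ι Q₂ b)) := by
    rw [mul_assoc, h, mul_neg]
  have hb : ι Q₂ a * ι Q₂ b * ι Q₂ b = -(ι Q₂ b * (ι Q₂ a * ι Q₂ b)) := by
    rw [← mul_assoc, h, neg_mul, neg_neg]
  simp only [map_add, map_smul, mul_add, add_mul, mul_smul_comm, smul_mul_assoc, ha, hb]
  simp only [smul_neg, neg_add]

/-- If `a, b` is an orthogonal pair spanning `M₂` and `c = -(Q₂ a * Q₂ b)` is a unit, then the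
Clifford algebra of `c Q₁ ⊕ Q₂` is the ungraded tensor product of those of `Q₁` and `Q₂`. -/
noncomputable def tensorEquivOfOrthogonalPair {c : Rˣ} (hab : Q₂.IsOrtho a b)
    (hspan : ∀ v : M₂, ∃ x y : R, v = x • a + y • b) (hc : (c : R) = -(Q₂ a * Q₂ b)) :
    CliffordAlgebra (((c : R) • Q₁).prod Q₂) ≃ₐ[R] CliffordAlgebra Q₁ ⊗[R] CliffordAlgebra Q₂ :=
  twistedTensorEquiv Q₁ (ω := ι Q₂ a * ι Q₂ b) (by rw [ι_mul_ι_mul_self_of_isOrtho hab, hc])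
    (ι_mul_ι_mem_evenOdd_zero Q₂ a b) fun v => by
      obtain ⟨x, y, rfl⟩ := hspan v
      exact ι_mul_ι_anticomm_of_isOrtho hab x y

end CliffordAlgebra

/-- A bijection of index types compatible with the weights splits a weighted sum of squares
as an orthogonal direct sum, with the first summand scaled by `c`. -/
noncomputable def weightedSumSquaresSplit {R ι κ l : Type*} [CommRing R] [Fintype ι] [Fintype κ]
    [Fintype l] (e : κ ⊕ l ≃ ι) (c : R) (w : ι → R) (w₁ : κ → R) (w₂ : l → R)
    (h₁ : ∀ k, w (e (.inl k)) = c * w₁ k) (h₂ : ∀ k, w (e (.inr k)) = w₂ k) :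
    (QuadraticMap.weightedSumSquares R w).IsometryEquiv
      ((c • QuadraticMap.weightedSumSquares R w₁).prod (QuadraticMap.weightedSumSquares R w₂)) where
  toLinearEquiv := (LinearEquiv.funCongrLeft R R e).trans (LinearEquiv.sumArrowLequivProdArrow ..)
  map_app' x := by
    simp [QuadraticMap.weightedSumSquares_apply, ← e.sum_comp (fun i => w i * (x i * x i)), h₁, h₂,
      Finset.mul_sum, mul_assoc, LinearEquiv.funCongrLeft_apply, LinearMap.funLeft_apply]

/-- The coordinate splitting `ℝ^(s+t) ⊕ ℝ^(s'+t') ≃ ℝ^((s+s')+(t+t'))` on indices, keeping the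
first `s + s'` indices those of positive sign. -/
def finSignatureEquiv (s t s' t' : ℕ) : Fin (s + t) ⊕ Fin (s' + t') ≃ Fin (s + s' + (t + t')) :=
  (Equiv.sumCongr finSumFinEquiv.symm finSumFinEquiv.symm).trans <|
    (Equiv.sumSumSumComm ..).trans <|
      (Equiv.sumCongr finSumFinEquiv finSumFinEquiv).trans finSumFinEquiv

theorem finSignatureEquiv_inl_lt_iff (s t s' t' : ℕ) (k : Fin (s + t)) :
    (finSignatureEquiv s t s' t' (.inl k) : ℕ) < s + s' ↔ (k : ℕ) < s := by
  induction k using Fin.addCases with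
  | left i => simp [finSignatureEquiv]; omega
  | right i => simp [finSignatureEquiv]

theorem finSignatureEquiv_inr_lt_iff (s t s' t' : ℕ) (k : Fin (s' + t')) :
    (finSignatureEquiv s t s' t' (.inr k) : ℕ) < s + s' ↔ (k : ℕ) < s' := by
  induction k using Fin.addCases with
  | left i => simp [finSignatureEquiv]
  | right i => simp [finSignatureEquiv]

/-- Splitting off a two-dimensional summand of signature `(p, q)`, where `c = -1` in the definite
cases and `c = 1` for a hyperbolic plane. -/
theorem nonempty_cliffordAlgebra_Qst_algEquiv {u v s t p q : ℕ} (hpq : p + q = 2) (c : ℝˣ)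
    (hc : (c : ℝ) = -((if 0 < p then 1 else -1) * (if 1 < p then 1 else -1)))
    (e : Fin (s + t) ⊕ Fin (p + q) ≃ Fin (u + v))
    (h₁ : ∀ k, (if (e (.inl k) : ℕ) < u then (1 : ℝ) else -1) = c * if (k : ℕ) < s then 1 else -1)
    (h₂ : ∀ k, (e (.inr k) : ℕ) < u ↔ (k : ℕ) < p) :
    Nonempty (CliffordAlgebra (Qst u v) ≃ₐ[ℝ]
      (CliffordAlgebra (Qst s t) ⊗[ℝ] CliffordAlgebra (Qst p q))) := by
  let f := finCongr hpq
  have hQ (x : Fin (p + q) → ℝ) : Qst p q x =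
      (if 0 < p then 1 else -1) * (x (f.symm 0) * x (f.symm 0)) +
        (if 1 < p then 1 else -1) * (x (f.symm 1) * x (f.symm 1)) := by
    rw [Qst, QuadraticMap.weightedSumSquares_apply, ← f.symm.sum_comp, Fin.sum_univ_two]
    simp [f]
  have hne : f.symm 0 ≠ f.symm 1 := by simp
  refine ⟨(CliffordAlgebra.equivOfIsometry (weightedSumSquaresSplit e (c : ℝ) _ _ _ h₁ fun k => by
    simp only [h₂])).trans (CliffordAlgebra.tensorEquivOfOrthogonalPair _
      (a := Pi.single (f.symm 0) 1) (b := Pi.single (f.symm 1) 1) ?_ ?_ ?_)⟩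
  · change (Qst p q).IsOrtho _ _
    simp [QuadraticMap.isOrtho_def, hQ, hne, hne.symm]
  · refine fun x => ⟨x (f.symm 0), x (f.symm 1), funext fun i => ?_⟩
    obtain ⟨i, rfl⟩ := f.symm.surjective i
    fin_cases i <;> simp
  · change _ = -(Qst p q _ * Qst p q _)
    simp [hQ, hne, hne.symm, hc]

/-- **Tensor product splitting of geometric algebras:**
`G(n+2, 0) ≅ G(0, n) ⊗[ℝ] G(2, 0)`, `G(0, n+2) ≅ G(n, 0) ⊗[ℝ] G(0, 2)`, and
`G(s+1, t+1) ≅ G(s, t) ⊗[ℝ] G(1, 1)` as ℝ-algebras. -/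
theorem clifford_tensor_split (n s t : ℕ) :
    Nonempty (CliffordAlgebra (Qst (n + 2) 0) ≃ₐ[ℝ]
      (CliffordAlgebra (Qst 0 n) ⊗[ℝ] CliffordAlgebra (Qst 2 0))) ∧
    Nonempty (CliffordAlgebra (Qst 0 (n + 2)) ≃ₐ[ℝ]
      (CliffordAlgebra (Qst n 0) ⊗[ℝ] CliffordAlgebra (Qst 0 2))) ∧
    Nonempty (CliffordAlgebra (Qst (s + 1) (t + 1)) ≃ₐ[ℝ]
      (CliffordAlgebra (Qst s t) ⊗[ℝ] CliffordAlgebra (Qst 1 1))) := by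
  refine ⟨?_, ?_, ?_⟩
  · refine nonempty_cliffordAlgebra_Qst_algEquiv rfl (-1) (by simp)
      (finSumFinEquiv.trans (finCongr (by omega))) (fun k => ?_) (fun k => ?_)
    · rw [if_pos (Fin.isLt _)]
      simp
    · exact iff_of_true (Fin.isLt _) k.isLt
  · refine nonempty_cliffordAlgebra_Qst_algEquiv rfl (-1) (by simp)
      (finSumFinEquiv.trans (finCongr (by omega))) (fun k => ?_) (fun k => by simp)
    rw [if_pos (show (k : ℕ) < n from k.isLt)]
    simp
  · refine nonempty_cliffordAlgebra_Qst_algEquiv rfl 1 (by simp)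
      (finSignatureEquiv s t 1 1) (fun k => ?_) (finSignatureEquiv_inr_lt_iff s t 1 1)
    simp only [finSignatureEquiv_inl_lt_iff, Units.val_one, one_mul]
end

section
/- For every natural number n there are isomorphisms: G(n+8, 0) ≅ G(n, 0) ⊗[ℝ] G(8, 0) and G(0, n+8) ≅ G(0, n) ⊗[ℝ] G(0, 8) as ℝ-algebras, and Gℂ(n+2) ≅ Gℂ(n) ⊗[ℂ] Gℂ(2) as ℂ-algebras. -/
open scoped TensorProduct

/-- The standard nondegenerate quadratic form `z ↦ Σ_{i < n} z i ^ 2` on `ℂⁿ`. -/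
noncomputable def QC (n : ℕ) : QuadraticForm ℂ (Fin n → ℂ) :=
  QuadraticMap.weightedSumSquares ℂ (fun _ : Fin n => (1 : ℂ))

namespace CliffordAlgebra

section VolumeElement

variable {R M₁ M₂ : Type*} [CommRing R] [AddCommGroup M₁] [AddCommGroup M₂]
  [Module R M₁] [Module R M₂] {Q₁ : QuadraticForm R M₁} {Q₂ : QuadraticForm R M₂}

/-- Algebra homomorphisms out of two Clifford algebras have commuting images as soon as they
commute on generators. -/
theorem commute_of_commute_ι {A : Type*} [Ring A] [Algebra R A]
    (f : CliffordAlgebra Q₁ →ₐ[R] A) (g : CliffordAlgebra Q₂ →ₐ[R] A)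
    (h : ∀ v w, Commute (f (ι Q₁ v)) (g (ι Q₂ w))) (x : CliffordAlgebra Q₁)
    (y : CliffordAlgebra Q₂) : Commute (f x) (g y) := by
  induction x using CliffordAlgebra.induction with
  | algebraMap r => rw [AlgHom.commutes]; exact Algebra.commutes r _
  | mul a b ha hb => rw [map_mul]; exact ha.mul_left hb
  | add a b ha hb => rw [map_add]; exact ha.add_left hb
  | ι v =>
    induction y using CliffordAlgebra.induction with
    | algebraMap r => rw [AlgHom.commutes]; exact (Algebra.commutes r _).symm
    | mul a b ha hb => rw [map_mul]; exact ha.mul_right hb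
    | add a b ha hb => rw [map_add]; exact ha.add_right hb
    | ι w => exact h v w

variable (Q₂) in
/-- An even element of a Clifford algebra which squares to `1` and anticommutes with all vectors,
such as the volume element of a suitable even-dimensional quadratic space. -/
structure IsSplitVolume (ω : CliffordAlgebra Q₂) : Prop where
  mul_self : ω * ω = 1
  anticomm : ∀ w, ω * ι Q₂ w = -(ι Q₂ w * ω)
  even : ω ∈ evenOdd Q₂ 0

namespace IsSplitVolume

variable {ω : CliffordAlgebra Q₂}

variable (Q₁) in
/-- The homomorphism sending `(v, w)` to `v ⊗ ω + 1 ⊗ w`. -/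
noncomputable def prodToTensor (hω : IsSplitVolume Q₂ ω) :
    CliffordAlgebra (Q₁.prod Q₂) →ₐ[R] CliffordAlgebra Q₁ ⊗[R] CliffordAlgebra Q₂ :=
  lift (Q₁.prod Q₂)
    ⟨((TensorProduct.mk R _ _).flip ω ∘ₗ ι Q₁).coprod (TensorProduct.mk R _ _ 1 ∘ₗ ι Q₂), by
      rintro ⟨v, w⟩
      simp only [LinearMap.coprod_apply, LinearMap.comp_apply, LinearMap.flip_apply,
        TensorProduct.mk_apply, add_mul, mul_add, Algebra.TensorProduct.tmul_mul_tmul,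
        ι_sq_scalar, hω.mul_self, hω.anticomm, one_mul, mul_one, TensorProduct.tmul_neg,
        QuadraticMap.prod_apply, map_add]
      rw [← Algebra.TensorProduct.algebraMap_apply, Algebra.algebraMap_eq_smul_one (Q₂ w),
        TensorProduct.tmul_smul, ← Algebra.TensorProduct.one_def,
        ← Algebra.algebraMap_eq_smul_one]
      abel⟩

@[simp]
theorem prodToTensor_ι (hω : IsSplitVolume Q₂ ω) (v : M₁) (w : M₂) :
    hω.prodToTensor Q₁ (ι _ (v, w)) = ι Q₁ v ⊗ₜ ω + 1 ⊗ₜ ι Q₂ w :=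
  (lift_ι_apply _ _ _).trans (by simp)

theorem prodToTensor_map_inr (hω : IsSplitVolume Q₂ ω) (x : CliffordAlgebra Q₂) :
    hω.prodToTensor Q₁ (map (.inr Q₁ Q₂) x) = 1 ⊗ₜ x := by
  have h : (hω.prodToTensor Q₁).comp (map (.inr Q₁ Q₂)) =
      Algebra.TensorProduct.includeRight := by
    ext w
    simp
  exact DFunLike.congr_fun h x

theorem map_inr_mul_self (hω : IsSplitVolume Q₂ ω) :
    map (.inr Q₁ Q₂) ω * map (.inr Q₁ Q₂) ω = 1 := by
  rw [← map_mul, hω.mul_self, map_one]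

theorem map_inr_mul_ι_inr (hω : IsSplitVolume Q₂ ω) (w : M₂) :
    map (.inr Q₁ Q₂) ω * ι (Q₁.prod Q₂) (0, w) =
      -(ι (Q₁.prod Q₂) (0, w) * map (.inr Q₁ Q₂) ω) := by
  simpa using congrArg (map (.inr Q₁ Q₂)) (hω.anticomm w)

theorem commute_ι_inl_map_inr (hω : IsSplitVolume Q₂ ω) (v : M₁) :
    Commute (ι (Q₁.prod Q₂) (v, 0)) (map (.inr Q₁ Q₂) ω) := by
  simpa using commute_map_mul_map_of_isOrtho_of_mem_evenOdd_zero_right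
    (.inl Q₁ Q₂) (.inr Q₁ Q₂) (fun _ _ => QuadraticMap.IsOrtho.inl_inr _ _) _ _
    (ι_mem_evenOdd_one Q₁ v) hω.even

variable (Q₁) in
/-- The homomorphism sending `v` to `v * ω`. -/
noncomputable def twistedInl (hω : IsSplitVolume Q₂ ω) :
    CliffordAlgebra Q₁ →ₐ[R] CliffordAlgebra (Q₁.prod Q₂) :=
  lift Q₁ ⟨LinearMap.mulRight R (map (.inr Q₁ Q₂) ω) ∘ₗ ι (Q₁.prod Q₂) ∘ₗ LinearMap.inl R M₁ M₂,
    fun v => by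
      have h := hω.commute_ι_inl_map_inr (Q₁ := Q₁) v
      simp only [LinearMap.comp_apply, LinearMap.inl_apply, LinearMap.mulRight_apply]
      rw [h.symm.mul_mul_mul_comm, hω.map_inr_mul_self, mul_one, ι_sq_scalar]
      simp⟩

@[simp]
theorem twistedInl_ι (hω : IsSplitVolume Q₂ ω) (v : M₁) :
    hω.twistedInl Q₁ (ι Q₁ v) = ι (Q₁.prod Q₂) (v, 0) * map (.inr Q₁ Q₂) ω := by
  simp [twistedInl]

theorem commute_twistedInl_map_inr (hω : IsSplitVolume Q₂ ω) (x : CliffordAlgebra Q₁)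
    (y : CliffordAlgebra Q₂) : Commute (hω.twistedInl Q₁ x) (map (.inr Q₁ Q₂) y) := by
  refine commute_of_commute_ι _ _ (fun v w => ?_) x y
  have h : ι (Q₁.prod Q₂) (v, 0) * ι (Q₁.prod Q₂) (0, w) =
      -(ι (Q₁.prod Q₂) (0, w) * ι (Q₁.prod Q₂) (v, 0)) :=
    ι_mul_ι_comm_of_isOrtho (QuadraticMap.IsOrtho.inl_inr _ _)
  rw [twistedInl_ι, map_apply_ι, QuadraticMap.Isometry.inr_apply, commute_iff_eq, mul_assoc,
    hω.map_inr_mul_ι_inr, mul_neg, ← mul_assoc, h, neg_mul, neg_neg, mul_assoc]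

variable (Q₁) in
/-- If the Clifford algebra of `Q₂` has an even element squaring to `1` and anticommuting with
vectors, then the Clifford algebra of `Q₁ ⊕ Q₂` is the ungraded tensor product of those of `Q₁`
and `Q₂`. -/
noncomputable def prodEquivTensor (hω : IsSplitVolume Q₂ ω) :
    CliffordAlgebra (Q₁.prod Q₂) ≃ₐ[R] CliffordAlgebra Q₁ ⊗[R] CliffordAlgebra Q₂ :=
  AlgEquiv.ofAlgHom (hω.prodToTensor Q₁)
    (Algebra.TensorProduct.lift (hω.twistedInl Q₁) (map (.inr Q₁ Q₂))
      hω.commute_twistedInl_map_inr)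
    (by
      ext v
      · simp [hω.prodToTensor_map_inr, hω.mul_self]
      · simp)
    (by
      ext v
      · simp [mul_assoc, hω.map_inr_mul_self]
      · simp)

end IsSplitVolume

end VolumeElement

section OrthogonalBasis

variable {R : Type*} [CommRing R]

/-- The sum of squares on `ι → R`, scaled by `c`. -/
noncomputable abbrev scaledSumSquares (ι : Type*) [Fintype ι] (c : R) : QuadraticForm R (ι → R) :=
  QuadraticMap.weightedSumSquares R fun _ : ι => c

variable {ι₁ ι₂ ι₃ : Type*} [Fintype ι₁] [Fintype ι₂] [Fintype ι₃]

/-- The scaled sum of squares over a disjoint union is the product of those over the parts. -/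
def scaledSumSquaresSum (c : R) (e : ι₁ ⊕ ι₂ ≃ ι₃) :
    (scaledSumSquares ι₃ c).IsometryEquiv
      ((scaledSumSquares ι₁ c).prod (scaledSumSquares ι₂ c)) where
  __ := (LinearEquiv.funCongrLeft R R e).trans (LinearEquiv.sumArrowLequivProdArrow ι₁ ι₂ R R)
  map_app' m := by
    simp [← e.sum_comp, QuadraticMap.weightedSumSquares_apply, LinearMap.funLeft]

variable [DecidableEq ι₁] (c : R)

/-- The generator of the Clifford algebra given by the `i`-th standard basis vector. -/
noncomputable abbrev ιSingle (i : ι₁) : CliffordAlgebra (scaledSumSquares ι₁ c) :=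
  ι (scaledSumSquares ι₁ c) (Pi.single i 1)

theorem ι_single_mul_self (i : ι₁) : ιSingle c i * ιSingle c i = c • 1 := by
  simp [ι_sq_scalar, Pi.single_apply, Algebra.algebraMap_eq_smul_one]

theorem ι_single_mul_ι_single {i j : ι₁} (h : i ≠ j) :
    ιSingle c i * ιSingle c j = -(ιSingle c j * ιSingle c i) := by
  refine ι_mul_ι_comm_of_isOrtho ?_
  rw [QuadraticMap.isOrtho_def]
  simp only [QuadraticMap.weightedSumSquares_apply, ← Finset.sum_add_distrib, Pi.add_apply]
  refine Finset.sum_congr rfl fun k _ => ?_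
  rcases eq_or_ne k i with rfl | hk
  · simp [h]
  · simp [hk]

theorem anticomm_ι_of_anticomm_ι_single {x : CliffordAlgebra (scaledSumSquares ι₁ c)}
    (h : ∀ i, x * ιSingle c i = -(ιSingle c i * x)) (w : ι₁ → R) :
    x * ι (scaledSumSquares ι₁ c) w = -(ι (scaledSumSquares ι₁ c) w * x) := by
  have hw : w = ∑ i, w i • Pi.single i 1 := by
    simpa using pi_eq_sum_univ' w
  rw [hw]
  simp only [map_sum, map_smul, Finset.mul_sum, Finset.sum_mul, mul_smul_comm, smul_mul_assoc, h,
    smul_neg, Finset.sum_neg_distrib]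

end OrthogonalBasis

section Anticommuting

variable {R A κ : Type*} [CommRing R] [Ring A] [Algebra R A] {e : κ → A} {c : R}

theorem mul_swap_of_lt [LinearOrder κ] (h : ∀ i j, i ≠ j → e i * e j = -(e j * e i))
    {i j : κ} (hij : i < j) : e j * e i = -(e i * e j) := h _ _ hij.ne'

theorem mul_swap_assoc_of_lt [LinearOrder κ] (h : ∀ i j, i ≠ j → e i * e j = -(e j * e i))
    {i j : κ} (hij : i < j) (x : A) : e j * (e i * x) = -(e i * (e j * x)) := by
  rw [← mul_assoc, mul_swap_of_lt h hij, neg_mul, mul_assoc]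

theorem mul_self_assoc (h : ∀ i, e i * e i = c • 1) (i : κ) (x : A) :
    e i * (e i * x) = c • x := by
  rw [← mul_assoc, h, smul_mul_assoc, one_mul]

end Anticommuting

theorem isSplitVolume_eight {R : Type*} [CommRing R] {c : R} (hc : c * c = 1) :
    ∃ ω, IsSplitVolume (scaledSumSquares (Fin 8) c) ω := by
  let e : Fin 8 → CliffordAlgebra (scaledSumSquares (Fin 8) c) := ιSingle c
  have hs : ∀ i, e i * e i = c • 1 := ι_single_mul_self c
  have ha : ∀ i j, i ≠ j → e i * e j = -(e j * e i) := fun i j => ι_single_mul_ι_single c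
  have hcc (x : CliffordAlgebra (scaledSumSquares (Fin 8) c)) : c • c • x = x := by
    rw [smul_smul, hc, one_smul]
  refine ⟨(e 0 * e 1) * (e 2 * e 3) * ((e 4 * e 5) * (e 6 * e 7)), ?_, ?_, ?_⟩
  · simp (disch := decide) only [mul_assoc, hs, mul_self_assoc hs, mul_swap_assoc_of_lt ha, mul_neg,
      neg_neg, mul_smul_comm, hcc]
  · refine anticomm_ι_of_anticomm_ι_single c fun i => ?_
    change _ * e i = -(e i * _)
    fin_cases i <;>
      simp (disch := decide) [mul_assoc, hs, mul_self_assoc hs, mul_swap_of_lt ha,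
        mul_swap_assoc_of_lt ha]
  · have h (i j) : e i * e j ∈ evenOdd (scaledSumSquares (Fin 8) c) 0 :=
      ι_mul_ι_mem_evenOdd_zero _ _ _
    have hm {x y} (hx : x ∈ evenOdd (scaledSumSquares (Fin 8) c) 0)
        (hy : y ∈ evenOdd (scaledSumSquares (Fin 8) c) 0) :
        x * y ∈ evenOdd (scaledSumSquares (Fin 8) c) 0 := by
      simpa using SetLike.mul_mem_graded hx hy
    exact hm (hm (h _ _) (h _ _)) (hm (h _ _) (h _ _))

theorem isSplitVolume_two {R : Type*} [CommRing R] {c i : R} (hc : c * c = 1) (hi : i * i = -1) :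
    ∃ ω, IsSplitVolume (scaledSumSquares (Fin 2) c) ω := by
  let e : Fin 2 → CliffordAlgebra (scaledSumSquares (Fin 2) c) := ιSingle c
  have hs : ∀ i, e i * e i = c • 1 := ι_single_mul_self c
  have ha : ∀ i j, i ≠ j → e i * e j = -(e j * e i) := fun i j => ι_single_mul_ι_single c
  refine ⟨i • (e 0 * e 1), ?_, ?_, ?_⟩
  · simp (disch := decide) only [mul_assoc, hs, mul_self_assoc hs,
      mul_swap_assoc_of_lt ha, mul_neg, smul_mul_assoc, mul_smul_comm, smul_neg, smul_smul]
    rw [← neg_smul, show -(i * (i * (c * c))) = 1 by rw [hc, mul_one, hi, neg_neg], one_smul]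
  · refine anticomm_ι_of_anticomm_ι_single c fun j => ?_
    change _ * e j = -(e j * _)
    fin_cases j <;>
      simp (disch := decide) [mul_assoc, hs, mul_self_assoc hs, mul_swap_of_lt ha,
      mul_swap_assoc_of_lt ha]
  · exact Submodule.smul_mem _ _ (ι_mul_ι_mem_evenOdd_zero _ _ _)

/-- Clifford algebras of scaled sums of squares split off a tensor factor carrying a volume element
as in `IsSplitVolume`. -/
theorem nonempty_algEquiv_tensor {R ι₁ ι₂ ι₃ : Type*} [CommRing R] [Fintype ι₁] [Fintype ι₂]
    [Fintype ι₃] {c : R} {Q₁ : QuadraticForm R (ι₁ → R)} {Q₂ : QuadraticForm R (ι₂ → R)}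
    {Q₃ : QuadraticForm R (ι₃ → R)} (h₁ : Q₁ = scaledSumSquares ι₁ c)
    (h₂ : Q₂ = scaledSumSquares ι₂ c) (h₃ : Q₃ = scaledSumSquares ι₃ c) (e : ι₁ ⊕ ι₂ ≃ ι₃)
    (hω : ∃ ω, IsSplitVolume (scaledSumSquares ι₂ c) ω) :
    Nonempty (CliffordAlgebra Q₃ ≃ₐ[R] CliffordAlgebra Q₁ ⊗[R] CliffordAlgebra Q₂) := by
  subst h₁ h₂ h₃
  obtain ⟨ω, hω⟩ := hω
  exact ⟨(equivOfIsometry (scaledSumSquaresSum c e)).trans (hω.prodEquivTensor _)⟩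

end CliffordAlgebra

theorem Qst_zero_right (s : ℕ) : Qst s 0 = CliffordAlgebra.scaledSumSquares (Fin (s + 0)) 1 :=
  congrArg (QuadraticMap.weightedSumSquares ℝ) (funext fun i => if_pos i.isLt)

theorem Qst_zero_left (t : ℕ) : Qst 0 t = CliffordAlgebra.scaledSumSquares (Fin (0 + t)) (-1) :=
  congrArg (QuadraticMap.weightedSumSquares ℝ) (funext fun _ => if_neg (Nat.not_lt_zero _))

/-- **Periodicity isomorphisms:** `G(n+8, 0) ≅ G(n, 0) ⊗[ℝ] G(8, 0)`,
`G(0, n+8) ≅ G(0, n) ⊗[ℝ] G(0, 8)` as ℝ-algebras, and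
`Gℂ(n+2) ≅ Gℂ(n) ⊗[ℂ] Gℂ(2)` as ℂ-algebras. -/
theorem clifford_periodicity (n : ℕ) :
    Nonempty (CliffordAlgebra (Qst (n + 8) 0) ≃ₐ[ℝ]
      (CliffordAlgebra (Qst n 0) ⊗[ℝ] CliffordAlgebra (Qst 8 0))) ∧
    Nonempty (CliffordAlgebra (Qst 0 (n + 8)) ≃ₐ[ℝ]
      (CliffordAlgebra (Qst 0 n) ⊗[ℝ] CliffordAlgebra (Qst 0 8))) ∧
    Nonempty (CliffordAlgebra (QC (n + 2)) ≃ₐ[ℂ]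
      (CliffordAlgebra (QC n) ⊗[ℂ] CliffordAlgebra (QC 2))) := by
  refine ⟨?_, ?_, ?_⟩
  · exact CliffordAlgebra.nonempty_algEquiv_tensor (Qst_zero_right n) (Qst_zero_right 8)
      (Qst_zero_right (n + 8)) finSumFinEquiv (CliffordAlgebra.isSplitVolume_eight (one_mul 1))
  · exact CliffordAlgebra.nonempty_algEquiv_tensor (Qst_zero_left n) (Qst_zero_left 8)
      (Qst_zero_left (n + 8)) (finSumFinEquiv.trans (finCongr (by omega)))
      (CliffordAlgebra.isSplitVolume_eight (by norm_num))
  · exact CliffordAlgebra.nonempty_algEquiv_tensor rfl rfl rfl finSumFinEquiv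
      (CliffordAlgebra.isSplitVolume_two (one_mul 1) Complex.I_mul_I)
end

section
/- For every natural number k, the complex Clifford algebra Gℂ(2k) is isomorphic as a ℂ-algebra to the matrix algebra Matrix (Fin 2^k) (Fin 2^k) ℂ, and Gℂ(2k+1) is isomorphic as a ℂ-algebra to the product Matrix (Fin 2^k) (Fin 2^k) ℂ × Matrix (Fin 2^k) (Fin 2^k) ℂ. -/
namespace CliffordAlgebra

section Hyperbolic

variable {R M : Type*} [CommRing R] [AddCommGroup M] [Module R M] (Q : QuadraticForm R M)

/-- The hyperbolic plane: the quadratic form `(a, b) ↦ a * b` on `R × R`. -/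
def hyperbolicPlane (R : Type*) [CommRing R] : QuadraticForm R (R × R) :=
  QuadraticMap.linMulLin (LinearMap.fst R R R) (LinearMap.snd R R R)

@[simp]
theorem hyperbolicPlane_apply (x : R × R) : hyperbolicPlane R x = x.1 * x.2 := rfl

/-- The vector representation of `Q ⊥ H` in the `2 × 2` matrices over `CliffordAlgebra Q`. -/
def hyperbolicToMatrixAux :
    M × (R × R) →ₗ[R] Matrix (Fin 2) (Fin 2) (CliffordAlgebra Q) where
  toFun x := !![ι Q x.1, algebraMap R _ x.2.1; algebraMap R _ x.2.2, -ι Q x.1]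
  map_add' x y := by
    ext i j
    fin_cases i <;> fin_cases j <;> simp [add_comm]
  map_smul' r x := by
    ext i j
    fin_cases i <;> fin_cases j <;> simp [Algebra.smul_def]

/-- The algebra morphism from the Clifford algebra of `Q ⊥ H` to the `2 × 2` matrices over
`CliffordAlgebra Q`. -/
def hyperbolicToMatrix :
    CliffordAlgebra (Q.prod (hyperbolicPlane R)) →ₐ[R]
      Matrix (Fin 2) (Fin 2) (CliffordAlgebra Q) :=
  lift _ ⟨hyperbolicToMatrixAux Q, fun x => by
    ext i j
    fin_cases i <;> fin_cases j <;>
      simp [hyperbolicToMatrixAux, Matrix.mul_apply, Matrix.algebraMap_matrix_apply,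
        Algebra.commutes, ← map_mul, mul_comm, add_comm]⟩

theorem hyperbolicToMatrix_ι (x : M × (R × R)) :
    hyperbolicToMatrix Q (ι _ x) =
      !![ι Q x.1, algebraMap R _ x.2.1; algebraMap R _ x.2.2, -ι Q x.1] := by
  simp [hyperbolicToMatrix, hyperbolicToMatrixAux]

/-- The first isotropic generator of the hyperbolic summand. -/
def hypU : CliffordAlgebra (Q.prod (hyperbolicPlane R)) := ι _ (0, (1, 0))

/-- The second isotropic generator of the hyperbolic summand. -/
def hypV : CliffordAlgebra (Q.prod (hyperbolicPlane R)) := ι _ (0, (0, 1))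

theorem hypU_mul_hypU : hypU Q * hypU Q = 0 := by simp [hypU]

theorem hypV_mul_hypV : hypV Q * hypV Q = 0 := by simp [hypV]

theorem hypU_mul_hypV_add : hypU Q * hypV Q + hypV Q * hypU Q = 1 := by
  simp [hypU, hypV, ι_mul_ι_add_swap, QuadraticMap.polar]

theorem ι_mul_hypU (m : M) :
    ι (Q.prod (hyperbolicPlane R)) (m, 0) * hypU Q = -(hypU Q * ι _ (m, 0)) := by
  rw [eq_neg_iff_add_eq_zero]
  simp [hypU]

theorem ι_mul_hypV (m : M) :
    ι (Q.prod (hyperbolicPlane R)) (m, 0) * hypV Q = -(hypV Q * ι _ (m, 0)) := by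
  rw [eq_neg_iff_add_eq_zero]
  simp [hypV]

theorem hypU_mul_hypV_mul_hypU : hypU Q * hypV Q * hypU Q = hypU Q := by
  rw [eq_sub_of_add_eq (hypU_mul_hypV_add Q), sub_mul, mul_assoc, hypU_mul_hypU]
  simp

theorem hypV_mul_hypU_mul_hypV : hypV Q * hypU Q * hypV Q = hypV Q := by
  rw [eq_sub_of_add_eq' (hypU_mul_hypV_add Q), sub_mul, mul_assoc, hypV_mul_hypV]
  simp

/-- The volume element of the hyperbolic summand, normalised to square to one. -/
def hypVolume : CliffordAlgebra (Q.prod (hyperbolicPlane R)) :=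
  hypU Q * hypV Q - hypV Q * hypU Q

theorem hypVolume_mul_hypU : hypVolume Q * hypU Q = hypU Q := by
  rw [hypVolume, sub_mul, hypU_mul_hypV_mul_hypU, mul_assoc, hypU_mul_hypU]
  simp

theorem hypU_mul_hypVolume : hypU Q * hypVolume Q = -hypU Q := by
  rw [hypVolume, mul_sub, ← mul_assoc, ← mul_assoc, hypU_mul_hypV_mul_hypU, hypU_mul_hypU]
  simp

theorem hypVolume_mul_hypV : hypVolume Q * hypV Q = -hypV Q := by
  rw [hypVolume, sub_mul, hypV_mul_hypU_mul_hypV, mul_assoc, hypV_mul_hypV]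
  simp

theorem hypV_mul_hypVolume : hypV Q * hypVolume Q = hypV Q := by
  rw [hypVolume, mul_sub, ← mul_assoc, ← mul_assoc, hypV_mul_hypU_mul_hypV, hypV_mul_hypV]
  simp

theorem hypVolume_mul_hypVolume : hypVolume Q * hypVolume Q = 1 := by
  conv_lhs => enter [2]; rw [hypVolume]
  rw [mul_sub, ← mul_assoc, ← mul_assoc, hypVolume_mul_hypU, hypVolume_mul_hypV, neg_mul,
    sub_neg_eq_add, hypU_mul_hypV_add]

theorem commute_ι_hypVolume (m : M) :
    Commute (ι (Q.prod (hyperbolicPlane R)) (m, 0)) (hypVolume Q) := by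
  have huv : Commute (ι (Q.prod (hyperbolicPlane R)) (m, 0)) (hypU Q * hypV Q) := by
    rw [Commute, SemiconjBy, ← mul_assoc, ι_mul_hypU, neg_mul, mul_assoc, ι_mul_hypV, mul_neg,
      neg_neg, mul_assoc]
  have hvu : Commute (ι (Q.prod (hyperbolicPlane R)) (m, 0)) (hypV Q * hypU Q) := by
    rw [Commute, SemiconjBy, ← mul_assoc, ι_mul_hypV, neg_mul, mul_assoc, ι_mul_hypU, mul_neg,
      neg_neg, mul_assoc]
  exact huv.sub_right hvu

/-- The embedding of `CliffordAlgebra Q` onto the centralizer of the hyperbolic summand. -/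
def hyperbolicTwist : CliffordAlgebra Q →ₐ[R] CliffordAlgebra (Q.prod (hyperbolicPlane R)) :=
  lift Q ⟨(LinearMap.mulRight R (hypVolume Q)).comp
      ((ι (Q.prod (hyperbolicPlane R))).comp (LinearMap.inl R M (R × R))), fun m => by
    simp only [LinearMap.comp_apply, LinearMap.mulRight_apply, LinearMap.inl_apply]
    rw [(commute_ι_hypVolume Q m).symm.mul_mul_mul_comm, hypVolume_mul_hypVolume, ι_sq_scalar]
    simp⟩

theorem hyperbolicTwist_ι (m : M) :
    hyperbolicTwist Q (ι Q m) = ι _ (m, 0) * hypVolume Q := by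
  simp [hyperbolicTwist]

theorem commute_hyperbolicTwist_of_forall_ι {y : CliffordAlgebra (Q.prod (hyperbolicPlane R))}
    (h : ∀ m, Commute (hyperbolicTwist Q (ι Q m)) y) (x : CliffordAlgebra Q) :
    Commute (hyperbolicTwist Q x) y := by
  induction x using CliffordAlgebra.induction with
  | algebraMap r => rw [AlgHom.commutes]; exact Algebra.commutes r y
  | ι m => exact h m
  | mul a b ha hb => rw [map_mul]; exact ha.mul_left hb
  | add a b ha hb => rw [map_add]; exact ha.add_left hb

theorem commute_hyperbolicTwist_hypU (x : CliffordAlgebra Q) :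
    Commute (hyperbolicTwist Q x) (hypU Q) :=
  commute_hyperbolicTwist_of_forall_ι Q (fun m => by
    rw [Commute, SemiconjBy, hyperbolicTwist_ι, mul_assoc, hypVolume_mul_hypU, ι_mul_hypU,
      (commute_ι_hypVolume Q m).eq, ← mul_assoc, hypU_mul_hypVolume, neg_mul]) x

theorem commute_hyperbolicTwist_hypV (x : CliffordAlgebra Q) :
    Commute (hyperbolicTwist Q x) (hypV Q) :=
  commute_hyperbolicTwist_of_forall_ι Q (fun m => by
    rw [Commute, SemiconjBy, hyperbolicTwist_ι, mul_assoc, hypVolume_mul_hypV, mul_neg, ι_mul_hypV,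
      neg_neg, (commute_ι_hypVolume Q m).eq, ← mul_assoc, hypV_mul_hypVolume]) x

/-- The `2 × 2` matrix units spanned by the hyperbolic summand. -/
def hypUnit : Fin 2 → Fin 2 → CliffordAlgebra (Q.prod (hyperbolicPlane R)) :=
  !![hypU Q * hypV Q, hypU Q; hypV Q, hypV Q * hypU Q]

theorem hypUnit_mul_hypUnit (i j k l : Fin 2) :
    hypUnit Q i j * hypUnit Q k l = if j = k then hypUnit Q i l else 0 := by
  have huvv : hypU Q * hypV Q * hypV Q = 0 := by rw [mul_assoc, hypV_mul_hypV, mul_zero]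
  have hvuu : hypV Q * hypU Q * hypU Q = 0 := by rw [mul_assoc, hypU_mul_hypU, mul_zero]
  fin_cases i <;> fin_cases j <;> fin_cases k <;> fin_cases l <;>
    simp [hypUnit, ← mul_assoc, hypU_mul_hypU, hypV_mul_hypV, hypU_mul_hypV_mul_hypU,
      hypV_mul_hypU_mul_hypV, huvv, hvuu]

theorem commute_hyperbolicTwist_hypUnit (x : CliffordAlgebra Q) (i j : Fin 2) :
    Commute (hyperbolicTwist Q x) (hypUnit Q i j) := by
  have hu := commute_hyperbolicTwist_hypU Q x
  have hv := commute_hyperbolicTwist_hypV Q x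
  fin_cases i <;> fin_cases j
  exacts [hu.mul_right hv, hu, hv, hv.mul_right hu]

/-- The algebra morphism from the `2 × 2` matrices over `CliffordAlgebra Q` to the Clifford
algebra of `Q ⊥ H`. -/
def matrixToHyperbolic :
    Matrix (Fin 2) (Fin 2) (CliffordAlgebra Q) →ₐ[R]
      CliffordAlgebra (Q.prod (hyperbolicPlane R)) :=
  AlgHom.ofLinearMap
    { toFun := fun A => ∑ i, ∑ j, hyperbolicTwist Q (A i j) * hypUnit Q i j
      map_add' := fun A B => by simp [add_mul, Finset.sum_add_distrib]
      map_smul' := fun r A => by simp }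
    (by simp [hypUnit, hypU_mul_hypV_add])
    (fun A B => by
      have key (a b : CliffordAlgebra Q) (i j k l : Fin 2) :
          hyperbolicTwist Q a * hypUnit Q i j * (hyperbolicTwist Q b * hypUnit Q k l) =
            if j = k then hyperbolicTwist Q a * hyperbolicTwist Q b * hypUnit Q i l else 0 := by
        rw [(commute_hyperbolicTwist_hypUnit Q b i j).symm.mul_mul_mul_comm,
          hypUnit_mul_hypUnit, mul_ite, mul_zero]
      simp only [LinearMap.coe_mk, AddHom.coe_mk, Fin.sum_univ_two, Matrix.mul_apply, map_add,
        map_mul, add_mul, mul_add, key]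
      simp
      abel)

theorem matrixToHyperbolic_apply (A : Matrix (Fin 2) (Fin 2) (CliffordAlgebra Q)) :
    matrixToHyperbolic Q A = ∑ i, ∑ j, hyperbolicTwist Q (A i j) * hypUnit Q i j := rfl

theorem hyperbolicToMatrix_hypU : hyperbolicToMatrix Q (hypU Q) = !![0, 1; 0, 0] := by
  simp [hypU, hyperbolicToMatrix_ι]

theorem hyperbolicToMatrix_hypV : hyperbolicToMatrix Q (hypV Q) = !![0, 0; 1, 0] := by
  simp [hypV, hyperbolicToMatrix_ι]

theorem hyperbolicToMatrix_hypUnit (i j : Fin 2) :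
    hyperbolicToMatrix Q (hypUnit Q i j) = Matrix.single i j 1 := by
  ext k l
  fin_cases i <;> fin_cases j <;> fin_cases k <;> fin_cases l <;>
    simp [hypUnit, hyperbolicToMatrix_hypU, hyperbolicToMatrix_hypV, Matrix.single]

theorem hyperbolicToMatrix_hyperbolicTwist (x : CliffordAlgebra Q) :
    hyperbolicToMatrix Q (hyperbolicTwist Q x) = Matrix.scalar (Fin 2) x := by
  induction x using CliffordAlgebra.induction with
  | algebraMap r => simp only [AlgHom.commutes]; rfl
  | ι m =>
    ext i j
    fin_cases i <;> fin_cases j <;>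
      simp [hyperbolicTwist_ι, hypVolume, hyperbolicToMatrix_hypU, hyperbolicToMatrix_hypV,
        hyperbolicToMatrix_ι, Matrix.mul_apply]
  | mul a b ha hb => simp only [map_mul, ha, hb]
  | add a b ha hb => simp only [map_add, ha, hb]

/-- The Clifford algebra of `Q ⊥ H`, with `H` a hyperbolic plane, is the algebra of `2 × 2`
matrices over the Clifford algebra of `Q`. -/
def prodHyperbolicEquiv :
    CliffordAlgebra (Q.prod (hyperbolicPlane R)) ≃ₐ[R]
      Matrix (Fin 2) (Fin 2) (CliffordAlgebra Q) :=
  AlgEquiv.ofAlgHom (hyperbolicToMatrix Q) (matrixToHyperbolic Q)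
    (AlgHom.ext fun A => by
      simp only [AlgHom.comp_apply, AlgHom.id_apply, matrixToHyperbolic_apply, map_sum, map_mul,
        hyperbolicToMatrix_hypUnit, hyperbolicToMatrix_hyperbolicTwist]
      ext i j
      fin_cases i <;> fin_cases j <;> simp [Matrix.single])
    (hom_ext <| LinearMap.ext fun ⟨m, a, b⟩ => by
      have hx : ((m, a, b) : M × R × R) = (m, 0) + a • (0, (1, 0)) + b • (0, (0, 1)) := by simp
      have hι : ι (Q.prod (hyperbolicPlane R)) (m, a, b) =
          ι _ (m, 0) + a • hypU Q + b • hypV Q := by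
        rw [hx, map_add, map_add, map_smul, map_smul, hypU, hypV]
      have hm : ι (Q.prod (hyperbolicPlane R)) (m, 0) * hypVolume Q * hypVolume Q =
          ι _ (m, 0) := by
        rw [mul_assoc, hypVolume_mul_hypVolume, mul_one]
      simp only [LinearMap.comp_apply, AlgHom.toLinearMap_apply, AlgHom.comp_apply,
        AlgHom.id_apply, matrixToHyperbolic_apply, hyperbolicToMatrix_ι]
      conv_rhs => rw [hι, ← hm]
      conv_rhs => enter [1, 1, 2]; rw [hypVolume]
      simp [hypUnit, hyperbolicTwist_ι, Algebra.smul_def, mul_sub]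
      abel)

end Hyperbolic

end CliffordAlgebra

/-- Matrices over a product of algebras are pairs of matrices. -/
noncomputable def Matrix.prodAlgEquiv (R n A B : Type*) [CommSemiring R] [Fintype n] [DecidableEq n]
    [Semiring A] [Semiring B] [Algebra R A] [Algebra R B] :
    Matrix n n (A × B) ≃ₐ[R] Matrix n n A × Matrix n n B :=
  AlgEquiv.ofBijective
    ((AlgHom.fst R A B).mapMatrix.prod (AlgHom.snd R A B).mapMatrix)
    ⟨fun X Y h => by
      ext i j
      · exact congrFun (congrFun (congrArg Prod.fst h) i) j
      · exact congrFun (congrFun (congrArg Prod.snd h) i) j,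
    fun X => ⟨Matrix.of fun i j => (X.1 i j, X.2 i j), rfl⟩⟩

theorem QC_apply (n : ℕ) (z : Fin n → ℂ) : QC n z = ∑ i, z i * z i := by
  simp [QC, QuadraticMap.weightedSumSquares_apply]

open CliffordAlgebra

/-- Over `ℂ`, the sum of two squares is a hyperbolic plane. -/
noncomputable def QCAddTwoEquiv (n : ℕ) :
    (QC (n + 2)).IsometryEquiv ((QC n).prod (hyperbolicPlane ℂ)) where
  toFun z := (fun i => z i.succ.succ, (z 0 + Complex.I * z 1, z 0 - Complex.I * z 1))
  invFun w := Fin.cons ((w.2.1 + w.2.2) / 2)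
    (Fin.cons (-Complex.I * (w.2.1 - w.2.2) / 2) w.1)
  map_add' z w := by
    ext <;> simp <;> ring
  map_smul' c z := by
    ext <;> simp <;> ring
  left_inv z := by
    ext i
    refine Fin.cases ?_ (fun i => Fin.cases ?_ (fun i => ?_) i) i
    · simp
    · simp only [Fin.cons_succ, Fin.cons_zero]
      rw [Fin.succ_zero_eq_one]
      linear_combination -z 1 * Complex.I_mul_I
    · simp
  right_inv w := by
    ext
    · simp
    · simp only [Fin.cons_zero, Fin.cons_one]
      linear_combination -(w.2.1 - w.2.2) / 2 * Complex.I_mul_I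
    · simp only [Fin.cons_zero, Fin.cons_one]
      linear_combination (w.2.1 - w.2.2) / 2 * Complex.I_mul_I
  map_app' z := by
    simp only [QuadraticMap.prod_apply, QC_apply, hyperbolicPlane_apply, Fin.sum_univ_succ]
    simp only [Fin.succ_zero_eq_one]
    linear_combination -(z 1 * z 1) * Complex.I_mul_I

/-- Periodicity of the complex Clifford algebras. -/
noncomputable def cliffordQCAddTwoEquiv (n : ℕ) :
    CliffordAlgebra (QC (n + 2)) ≃ₐ[ℂ] Matrix (Fin 2) (Fin 2) (CliffordAlgebra (QC n)) :=
  (equivOfIsometry (QCAddTwoEquiv n)).trans (prodHyperbolicEquiv (QC n))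

/-- The Clifford algebra of the zero-dimensional form is `ℂ`. -/
noncomputable def cliffordQCZeroEquiv : CliffordAlgebra (QC 0) ≃ₐ[ℂ] ℂ :=
  AlgEquiv.ofAlgHom
    (lift (QC 0) ⟨0, fun z => by simp [QC_apply]⟩)
    (Algebra.ofId ℂ _)
    (by ext)
    (hom_ext <| LinearMap.ext fun z => by rw [Subsingleton.elim z 0, map_zero, map_zero])

/-- The morphism `ℂ × ℂ → A` determined by a square root of one in `A`. -/
noncomputable def prodLiftOfSqEqOne {A : Type*} [Ring A] [Algebra ℂ A] (e : A) (he : e * e = 1) :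
    ℂ × ℂ →ₐ[ℂ] A :=
  AlgHom.ofLinearMap
    { toFun := fun x => ((x.1 + x.2) / 2) • 1 + ((x.1 - x.2) / 2) • e
      map_add' := fun x y => by simp only [Prod.fst_add, Prod.snd_add]; module
      map_smul' := fun c x => by
        simp only [Prod.smul_fst, Prod.smul_snd, smul_eq_mul, RingHom.id_apply]; module }
    (by simp)
    (fun x y => by
      simp only [LinearMap.coe_mk, AddHom.coe_mk, Prod.fst_mul, Prod.snd_mul, add_mul, mul_add,
        smul_mul_smul_comm, he, one_mul, mul_one]
      module)

/-- The algebra morphism from the Clifford algebra of the one-dimensional form to `ℂ × ℂ`. -/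
noncomputable def cliffordQCOneToProd : CliffordAlgebra (QC 1) →ₐ[ℂ] ℂ × ℂ :=
  lift (QC 1) ⟨(LinearMap.proj 0).prod (-LinearMap.proj 0), fun z => by
    ext <;> simp [QC_apply]⟩

theorem cliffordQCOneToProd_ι (z : Fin 1 → ℂ) : cliffordQCOneToProd (ι _ z) = (z 0, -z 0) :=
  lift_ι_apply _ _ _

/-- The Clifford algebra of the one-dimensional form is `ℂ × ℂ`. -/
noncomputable def cliffordQCOneEquiv : CliffordAlgebra (QC 1) ≃ₐ[ℂ] ℂ × ℂ :=
  AlgEquiv.ofAlgHom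
    cliffordQCOneToProd
    (prodLiftOfSqEqOne (ι (QC 1) 1) (by simp [QC_apply]))
    (AlgHom.ext fun x => by
      ext <;> simp [prodLiftOfSqEqOne, cliffordQCOneToProd_ι] <;> ring)
    (hom_ext <| LinearMap.ext fun z => by
      have hz : z = z 0 • (1 : Fin 1 → ℂ) := by
        ext i
        simp [Subsingleton.elim i 0]
      conv_rhs => rw [hz]
      simp [prodLiftOfSqEqOne, cliffordQCOneToProd_ι])

/-- A `2 × 2` matrix of square matrices of size `2 ^ k` is a square matrix of size
`2 ^ (k + 1)`. -/
def matrixTwoPowSuccEquiv (k : ℕ) :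
    Matrix (Fin 2) (Fin 2) (Matrix (Fin (2 ^ k)) (Fin (2 ^ k)) ℂ) ≃ₐ[ℂ]
      Matrix (Fin (2 ^ (k + 1))) (Fin (2 ^ (k + 1))) ℂ :=
  (Matrix.compAlgEquiv (Fin 2) (Fin (2 ^ k)) ℂ ℂ).trans
    (Matrix.reindexAlgEquiv ℂ ℂ (finProdFinEquiv.trans (finCongr (pow_succ' 2 k).symm)))

/-- A matrix algebra of size one is its coefficient ring. -/
noncomputable def matrixTwoPowZeroEquiv : Matrix (Fin (2 ^ 0)) (Fin (2 ^ 0)) ℂ ≃ₐ[ℂ] ℂ :=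
  AlgEquiv.symm <| AlgEquiv.ofBijective (Algebra.ofId ℂ _)
    ⟨(algebraMap ℂ _).injective, fun A => ⟨A 0 0, by
      ext i j
      rw [Subsingleton.elim (α := Fin 1) i 0, Subsingleton.elim (α := Fin 1) j 0]
      simp [Algebra.ofId_apply, Matrix.algebraMap_matrix_apply]⟩⟩

/-- **Classification of complex Clifford algebras:**
`Gℂ(2k) ≅ ℂ^{2ᵏ×2ᵏ}` and `Gℂ(2k+1) ≅ ℂ^{2ᵏ×2ᵏ} ⊕ ℂ^{2ᵏ×2ᵏ}` as ℂ-algebras. -/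
theorem complex_clifford_classification (k : ℕ) :
    Nonempty (CliffordAlgebra (QC (2 * k)) ≃ₐ[ℂ] Matrix (Fin (2 ^ k)) (Fin (2 ^ k)) ℂ) ∧
    Nonempty (CliffordAlgebra (QC (2 * k + 1)) ≃ₐ[ℂ]
      (Matrix (Fin (2 ^ k)) (Fin (2 ^ k)) ℂ × Matrix (Fin (2 ^ k)) (Fin (2 ^ k)) ℂ)) := by
  induction k with
  | zero =>
    exact ⟨⟨cliffordQCZeroEquiv.trans matrixTwoPowZeroEquiv.symm⟩,
      ⟨cliffordQCOneEquiv.trans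
        (AlgEquiv.prodCongr matrixTwoPowZeroEquiv.symm matrixTwoPowZeroEquiv.symm)⟩⟩
  | succ k ih =>
    obtain ⟨⟨e⟩, ⟨f⟩⟩ := ih
    exact ⟨⟨(cliffordQCAddTwoEquiv (2 * k)).trans (e.mapMatrix.trans (matrixTwoPowSuccEquiv k))⟩,
      ⟨(cliffordQCAddTwoEquiv (2 * k + 1)).trans (f.mapMatrix.trans
        ((Matrix.prodAlgEquiv ℂ _ _ _).trans
          (AlgEquiv.prodCongr (matrixTwoPowSuccEquiv k) (matrixTwoPowSuccEquiv k))))⟩⟩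
end

section
/- Let V be a finite-dimensional real vector space and Q a nondegenerate quadratic form on V. If x ∈ CliffordAlgebra Q satisfies involute x * ι v = ι v * x for all v ∈ V, then x is a scalar, i.e., x lies in the range of the structure map algebraMap ℝ (CliffordAlgebra Q). -/
open CliffordAlgebra

section Contraction

variable {R M : Type*} [CommRing R] [AddCommGroup M] [Module R M]

/-- The twisted commutator with a vector `v` is the contraction with the polar form of `v`. -/
theorem CliffordAlgebra.ι_mul_sub_involute_mul_ι (Q : QuadraticForm R M) (v : M)
    (x : CliffordAlgebra Q) :
    ι Q v * x - involute x * ι Q v = contractLeft (Q.polarBilin v) x := by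
  induction x using CliffordAlgebra.left_induction with
  | algebraMap r =>
    rw [AlgHom.commutes, contractLeft_algebraMap, Algebra.commutes, sub_self]
  | add x y hx hy => rw [map_add, map_add, ← hx, ← hy]; noncomm_ring
  | ι_mul x a hx =>
    have h := ι_mul_ι_add_swap (Q := Q) v a
    rw [contractLeft_ι_mul, ← hx, map_mul, involute_ι, QuadraticMap.polarBilin_apply_apply,
      Algebra.smul_def, ← h]
    noncomm_ring

namespace ExteriorAlgebra

variable {I : Type*} [Fintype I]

/-- The Euler operator of the exterior algebra attached to a basis `b`: it maps `y` to
`∑ i, b i ∧ (b.coord i ⌋ y)`. -/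
noncomputable def eulerOperator (b : Module.Basis I R M) :
    ExteriorAlgebra R M →ₗ[R] ExteriorAlgebra R M :=
  ∑ i, LinearMap.mulLeft R (ExteriorAlgebra.ι R (b i)) ∘ₗ
    contractLeft (Q := (0 : QuadraticForm R M)) (b.coord i)

theorem eulerOperator_apply (b : Module.Basis I R M) (y : ExteriorAlgebra R M) :
    eulerOperator b y = ∑ i, ExteriorAlgebra.ι R (b i) *
      contractLeft (Q := (0 : QuadraticForm R M)) (b.coord i) y := by
  simp [eulerOperator]

theorem eulerOperator_ι_mul (b : Module.Basis I R M) (v : M) (y : ExteriorAlgebra R M) :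
    eulerOperator b (ExteriorAlgebra.ι R v * y) =
      ExteriorAlgebra.ι R v * y + ExteriorAlgebra.ι R v * eulerOperator b y := by
  have hv : ExteriorAlgebra.ι R v * y =
      ∑ i, b.coord i v • (ExteriorAlgebra.ι R (b i) * y) := by
    conv_lhs => rw [← b.sum_repr v, map_sum, Finset.sum_mul]
    simp
  rw [eulerOperator_apply, eulerOperator_apply]
  conv_rhs => rw [hv]
  rw [Finset.mul_sum, ← Finset.sum_add_distrib]
  refine Finset.sum_congr rfl fun i _ => ?_
  have h := ExteriorAlgebra.ι_add_mul_swap (R := R) (b i) v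
  rw [contractLeft_ι_mul, mul_sub, mul_smul_comm, ← mul_assoc, ← mul_assoc,
    eq_neg_of_add_eq_zero_left h]
  noncomm_ring

theorem eulerOperator_of_mem (b : Module.Basis I R M) {n : ℕ} {y : ExteriorAlgebra R M}
    (hy : y ∈ ⋀[R]^n M) : eulerOperator b y = (n : R) • y := by
  induction n generalizing y with
  | zero =>
    rw [exteriorPower, pow_zero] at hy
    obtain ⟨r, rfl⟩ := Submodule.mem_one.mp hy
    simp [eulerOperator_apply]
  | succ n ih =>
    rw [exteriorPower, pow_succ'] at hy
    refine Submodule.mul_induction_on hy ?_ fun x y hx hy => by rw [map_add, hx, hy, smul_add]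
    rintro _ ⟨v, rfl⟩ z hz
    rw [eulerOperator_ι_mul, ih hz, mul_smul_comm]
    push_cast
    module

theorem proj_eulerOperator (b : Module.Basis I R M) (n : ℕ) (y : ExteriorAlgebra R M) :
    GradedRing.proj (fun n => ⋀[R]^n M) n (eulerOperator b y) =
      (n : R) • GradedRing.proj (fun n => ⋀[R]^n M) n y := by
  induction y using DirectSum.Decomposition.inductionOn (fun n => ⋀[R]^n M) with
  | zero => simp
  | @homogeneous i m =>
    rw [eulerOperator_of_mem b m.2, GradedRing.proj_apply, GradedRing.proj_apply,
      DirectSum.decompose_smul (fun n => ⋀[R]^n M), DirectSum.smul_apply, Submodule.coe_smul]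
    obtain rfl | h := eq_or_ne i n
    · rfl
    · rw [DirectSum.decompose_of_mem_ne (fun n => ⋀[R]^n M) m.2 h, smul_zero, smul_zero]
  | add x y hx hy => rw [map_add, map_add, map_add, hx, hy, smul_add]

end ExteriorAlgebra

end Contraction

section Field

variable {K V : Type*} [Field K] [CharZero K] [AddCommGroup V] [Module K V]
  [FiniteDimensional K V]

theorem ExteriorAlgebra.mem_range_algebraMap_of_contractLeft_eq_zero
    {y : ExteriorAlgebra K V}
    (hy : ∀ d : Module.Dual K V, contractLeft (Q := (0 : QuadraticForm K V)) d y = 0) :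
    y ∈ Set.range (algebraMap K (ExteriorAlgebra K V)) := by
  classical
  have hE : eulerOperator (Module.finBasis K V) y = 0 := by
    simp [eulerOperator_apply, hy]
  have hproj : ∀ n : ℕ, n ≠ 0 → GradedRing.proj (fun n => ⋀[K]^n V) n y = 0 := fun n hn => by
    have h := proj_eulerOperator (Module.finBasis K V) n y
    rw [hE, map_zero, eq_comm, smul_eq_zero] at h
    exact h.resolve_left (Nat.cast_ne_zero.mpr hn)
  have hmem : y ∈ ⋀[K]^0 V := by
    rw [← DirectSum.sum_support_decompose (fun n => ⋀[K]^n V) y]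
    refine Submodule.sum_mem _ fun n _ => ?_
    obtain rfl | hn := eq_or_ne n 0
    · exact SetLike.coe_mem _
    · have h := hproj n hn
      rw [GradedRing.proj_apply] at h
      rw [h]
      exact zero_mem _
  rw [exteriorPower, pow_zero] at hmem
  exact Submodule.mem_one.mp hmem

theorem CliffordAlgebra.mem_range_algebraMap_of_contractLeft_eq_zero
    {Q : QuadraticForm K V} {x : CliffordAlgebra Q}
    (hx : ∀ d : Module.Dual K V, contractLeft d x = 0) :
    x ∈ Set.range (algebraMap K (CliffordAlgebra Q)) := by
  have : Invertible (2 : K) := invertibleOfNonzero two_ne_zero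
  obtain ⟨r, hr⟩ := ExteriorAlgebra.mem_range_algebraMap_of_contractLeft_eq_zero
    (y := equivExterior Q x) fun d => by
      have h := changeForm_contractLeft (changeForm.associated_neg_proof (Q := Q)) d x
      rw [hx, map_zero] at h
      exact h.symm
  refine ⟨r, (equivExterior Q).injective ?_⟩
  rw [← hr]
  exact changeForm_algebraMap (changeForm.associated_neg_proof (Q := Q)) r

end Field


/-- **Elements twisted-commuting with all vectors are scalars.**
If `Q` is a nondegenerate quadratic form on a finite-dimensional real vector space `V` and
`x ∈ CliffordAlgebra Q` satisfies `involute x * ι v = ι v * x` for all `v ∈ V`, then `x`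
is a scalar. -/
theorem mem_range_algebraMap_of_involute_comm
    (V : Type*) [AddCommGroup V] [Module ℝ V] [FiniteDimensional ℝ V]
    (Q : QuadraticForm ℝ V) (hQ : Q.polarBilin.Nondegenerate)
    (x : CliffordAlgebra Q)
    (hx : ∀ v : V, involute x * ι Q v = ι Q v * x) :
    x ∈ Set.range (algebraMap ℝ (CliffordAlgebra Q)) := by
  refine mem_range_algebraMap_of_contractLeft_eq_zero fun d => ?_
  obtain ⟨v, rfl⟩ := (LinearMap.BilinForm.toDual Q.polarBilin hQ).surjective d
  have h := ι_mul_sub_involute_mul_ι Q v x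
  rw [hx, sub_self] at h
  exact h.symm
end

section
/- (Cartan–Dieudonné) Let F be a field of characteristic ≠ 2, V a finite-dimensional F-vector space of dimension n, and Q a nondegenerate quadratic form on V. Then every isometry f of (V, Q) can be written as a composition f = r_{w₁} ∘ r_{w₂} ∘ ⋯ ∘ r_{w_k} of at most k ≤ n reflections, where each w_i ∈ V satisfies Q(w_i) ≠ 0 and r_w denotes the reflection u ↦ u − (polar Q u w / Q w) • w. -/
/-- The reflection along a vector `w` with `Q w ≠ 0`:
`u ↦ u - (polar Q u w / Q w) • w`. -/
noncomputable def reflAlong {F V : Type*} [Field F] [AddCommGroup V] [Module F V]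
    (Q : QuadraticForm F V) (w : V) : V → V :=
  fun u => u - (QuadraticMap.polar Q u w / Q w) • w

namespace CartanDieudonne

open QuadraticMap Module

variable {F V : Type*} [Field F] [AddCommGroup V] [Module F V] {Q : QuadraticForm F V}

lemma map_sub_eq_add_sub_polar (Q : QuadraticForm F V) (x y : V) :
    Q (x - y) = Q x + Q y - polar Q x y := by
  have h := polar_neg_right Q x y
  rw [polar, ← sub_eq_add_neg, QuadraticMap.map_neg] at h
  linear_combination h

lemma polar_map_map {f : End F V} (hf : ∀ v, Q (f v) = Q v) (x y : V) :
    polar Q (f x) (f y) = polar Q x y := by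
  simp only [polar, ← _root_.map_add, hf]

lemma exists_map_ne_zero [Nontrivial V] (hQ : ∀ x, (∀ y, polar Q x y = 0) → x = 0) :
    ∃ v, Q v ≠ 0 := by
  obtain ⟨x, hx⟩ := exists_ne (0 : V)
  by_contra! h
  exact hx (hQ x fun y => by simp [polar, h])

/-- The reflection along `w` as a linear endomorphism. -/
noncomputable def reflEnd (Q : QuadraticForm F V) (w : V) : End F V :=
  LinearMap.transvection (-(Q w)⁻¹ • Q.polarBilin w) w

lemma reflEnd_apply (w u : V) : reflEnd Q w u = u - (polar Q u w / Q w) • w := by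
  simp only [reflEnd, LinearMap.transvection.apply, LinearMap.smul_apply, polarBilin_apply_apply,
    smul_eq_mul, polar_comm Q w u]
  rw [sub_eq_add_neg, ← neg_smul]
  congr 2
  ring

lemma coe_reflEnd (w : V) : ⇑(reflEnd Q w) = reflAlong Q w :=
  funext fun u => reflEnd_apply w u

lemma map_reflEnd {w : V} (hw : Q w ≠ 0) (u : V) : Q (reflEnd Q w u) = Q u := by
  rw [reflEnd_apply, map_sub_eq_add_sub_polar, QuadraticMap.map_smul, polar_smul_right,
    smul_eq_mul, smul_eq_mul]
  field_simp
  ring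

lemma reflEnd_mul_self {w : V} (hw : Q w ≠ 0) : reflEnd Q w * reflEnd Q w = 1 := by
  ext u
  rw [End.mul_apply, reflEnd_apply, reflEnd_apply, polar_sub_left, polar_smul_left, polar_self,
    sub_sub, ← add_smul, End.one_apply, sub_eq_self]
  convert! zero_smul F w
  simp only [nsmul_eq_mul, smul_eq_mul]
  field_simp
  push_cast
  ring

lemma det_reflEnd [FiniteDimensional F V] {w : V} (hw : Q w ≠ 0) :
    LinearMap.det (reflEnd Q w) = -1 := by
  rw [reflEnd, LinearMap.transvection.det, LinearMap.smul_apply, polarBilin_apply_apply,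
    polar_self, nsmul_eq_mul, smul_eq_mul]
  field_simp
  push_cast
  ring

lemma reflEnd_sub_apply {x y : V} (hxy : Q x = Q y) (h : Q (x - y) ≠ 0) :
    reflEnd Q (x - y) x = y := by
  have : polar Q x (x - y) = Q (x - y) := by
    rw [map_sub_eq_add_sub_polar, polar_sub_right, polar_self, ← hxy, two_nsmul]
  rw [reflEnd_apply, this, div_self h, one_smul, sub_sub_cancel]

/-- `f` is a product of at most `n` reflections along vectors on which `Q` does not vanish. -/
def IsProdRefl (Q : QuadraticForm F V) (n : ℕ) (f : End F V) : Prop :=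
  ∃ l : List V, l.length ≤ n ∧ (∀ w ∈ l, Q w ≠ 0) ∧ f = (l.map (reflEnd Q)).prod

lemma IsProdRefl.of_reflEnd_mul {n : ℕ} {f : End F V} {w : V} (hw : Q w ≠ 0)
    (h : IsProdRefl Q n (reflEnd Q w * f)) : IsProdRefl Q (n + 1) f := by
  obtain ⟨l, hl, hlw, hf⟩ := h
  refine ⟨w :: l, by simpa using hl, by simpa [hw] using hlw, ?_⟩
  rw [List.map_cons, List.prod_cons, ← hf, ← mul_assoc, reflEnd_mul_self hw, one_mul]

lemma det_prod_reflEnd [FiniteDimensional F V] (l : List V) (hl : ∀ w ∈ l, Q w ≠ 0) :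
    LinearMap.det (l.map (reflEnd Q)).prod = (-1) ^ l.length := by
  induction l with
  | nil => simp
  | cons a l ih =>
    rw [List.map_cons, List.prod_cons, map_mul, det_reflEnd (hl a (by simp)),
      ih fun w hw => hl w (by simp [hw]), List.length_cons, pow_succ']

lemma coe_prod_reflEnd_restrict (W : Submodule F V) (l : List W) (x : W) :
    (((l.map (reflEnd (Q.comp W.subtype))).prod x : W) : V) =
      ((l.map (↑)).map (reflEnd Q)).prod (x : V) := by
  induction l with
  | nil => simp
  | cons a l ih =>
    simp only [List.map_cons, List.prod_cons, End.mul_apply, ← ih, reflEnd_apply]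
    rfl

lemma prod_reflEnd_apply_of_polar_eq_zero {v : V} (l : List V) (hl : ∀ w ∈ l, polar Q v w = 0) :
    (l.map (reflEnd Q)).prod v = v := by
  induction l with
  | nil => simp
  | cons a l ih =>
    rw [List.map_cons, List.prod_cons, End.mul_apply, ih fun w hw => hl w (by simp [hw]),
      reflEnd_apply, hl a (by simp), zero_div, zero_smul, sub_zero]

lemma sub_smul_mem_ker_polarBilin (hF : (2 : F) ≠ 0) {v : V} (hv : Q v ≠ 0) (z : V) :
    z - (polar Q v z / (2 * Q v)) • v ∈ LinearMap.ker (Q.polarBilin v) := by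
  rw [LinearMap.mem_ker, polarBilin_apply_apply, polar_sub_right, polar_smul_right, polar_self,
    nsmul_eq_mul, smul_eq_mul]
  field_simp
  push_cast
  ring

lemma separating_restrict_ker (hF : (2 : F) ≠ 0) (hQ : ∀ x, (∀ y, polar Q x y = 0) → x = 0)
    {v : V} (hv : Q v ≠ 0) (x : LinearMap.ker (Q.polarBilin v))
    (hx : ∀ y, polar (Q.comp (LinearMap.ker (Q.polarBilin v)).subtype) x y = 0) : x = 0 := by
  refine Subtype.ext (hQ x fun z => ?_)
  have h1 : polar Q x (z - (polar Q v z / (2 * Q v)) • v) = 0 :=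
    hx ⟨_, sub_smul_mem_ker_polarBilin hF hv z⟩
  have h2 : polar Q v x = 0 := x.2
  rwa [polar_sub_right, polar_smul_right, polar_comm Q x v, h2, smul_zero, sub_zero] at h1

lemma IsProdRefl.of_restrict_ker (hF : (2 : F) ≠ 0) {n : ℕ} {f : End F V}
    (hf : ∀ v, Q (f v) = Q v) {v : V} (hv : Q v ≠ 0) (hfv : f v = v)
    (ih : ∀ g : End F (LinearMap.ker (Q.polarBilin v)),
      (∀ x, Q (g x) = Q x) →
        IsProdRefl (Q.comp (LinearMap.ker (Q.polarBilin v)).subtype) n g) :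
    IsProdRefl Q n f := by
  have hmaps : ∀ x ∈ LinearMap.ker (Q.polarBilin v), f x ∈ LinearMap.ker (Q.polarBilin v) := by
    intro x hx
    rw [LinearMap.mem_ker, polarBilin_apply_apply] at hx ⊢
    rw [← hx, ← polar_map_map hf v x, hfv]
  obtain ⟨l, hl, hlw, hg⟩ := ih (f.restrict hmaps) fun x => hf x
  have hfix : ((l.map (↑)).map (reflEnd Q)).prod v = v := by
    refine prod_reflEnd_apply_of_polar_eq_zero _ fun w hw => ?_
    obtain ⟨w, -, rfl⟩ := List.mem_map.1 hw
    exact w.2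
  refine ⟨l.map (↑), by simpa using hl, ?_, LinearMap.ext fun z => ?_⟩
  · intro w hw
    obtain ⟨w', hw', rfl⟩ := List.mem_map.1 hw
    exact hlw w' hw'
  · have hx := sub_smul_mem_ker_polarBilin hF hv z
    have h := coe_prod_reflEnd_restrict (Q := Q) _ l ⟨_, hx⟩
    rw [← hg, LinearMap.coe_restrict_apply] at h
    simpa only [_root_.map_sub, _root_.map_smul, hfv, hfix, sub_left_inj] using h

lemma surjective_of_isometry [FiniteDimensional F V]
    (hQ : ∀ x, (∀ y, polar Q x y = 0) → x = 0) {f : End F V} (hf : ∀ v, Q (f v) = Q v) :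
    Function.Surjective f := by
  refine LinearMap.surjective_of_injective ((injective_iff_map_eq_zero f).2 fun x hx => ?_)
  exact hQ x fun y => by rw [← polar_map_map hf, hx, polar_zero_left]

lemma map_sub_eq_zero_of_forall [FiniteDimensional F V] (hF : (2 : F) ≠ 0)
    (hQ : ∀ x, (∀ y, polar Q x y = 0) → x = 0) {f : End F V} (hf : ∀ v, Q (f v) = Q v)
    (hfix : ∀ v, f v = v → Q v = 0) (h : ∀ v, Q v ≠ 0 → Q (f v - v) = 0) (v : V) : Q (f v - v) = 0 := by
  by_cases hv : Q v ≠ 0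
  · exact h v hv
  rw [not_not] at hv
  by_cases hw : ∃ w, polar Q v w = 0 ∧ Q w ≠ 0
  · obtain ⟨w, hvw, hw⟩ := hw
    have h1 := h (v + w) (by rwa [QuadraticMap.map_add Q, hv, hvw, zero_add, add_zero])
    have h2 := h (v - w) (by rwa [map_sub_eq_add_sub_polar, hv, hvw, zero_add, sub_zero])
    rw [_root_.map_add f, add_sub_add_comm, QuadraticMap.map_add Q, h w hw] at h1
    rw [_root_.map_sub f, sub_sub_sub_comm, map_sub_eq_add_sub_polar, h w hw] at h2
    have h3 : 2 * Q (f v - v) = 0 := by linear_combination h1 + h2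
    exact (mul_eq_zero.1 h3).resolve_left hF
  push Not at hw
  by_contra hg
  have hc : polar Q (f v) v ≠ 0 := by
    rw [map_sub_eq_add_sub_polar, hf, hv] at hg
    simpa using hg
  have hz : ∀ z, polar Q (f v) z = 0 → Q z = 0 := by
    intro z hz
    obtain ⟨x, rfl⟩ := surjective_of_isometry hQ hf z
    rw [polar_map_map hf] at hz
    rw [hf, hw x hz]
  have hy : polar Q (f v) (f (f v) - v) = 0 := by
    rw [polar_sub_right, polar_map_map hf, polar_comm Q v, sub_self]
  have hyv : polar Q (f (f v) - v) v = 0 := by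
    have := hz _ hy
    rw [map_sub_eq_add_sub_polar, hf, hf, hv, add_zero, zero_sub, neg_eq_zero] at this
    rw [polar_sub_left, this, polar_self, hv, nsmul_zero, sub_zero]
  have hffv : f (f v) = v := by
    refine sub_eq_zero.1 (hQ _ fun z => ?_)
    have h1 : polar Q (f v) (z - (polar Q (f v) z / polar Q (f v) v) • v) = 0 := by
      rw [polar_sub_right, polar_smul_right, smul_eq_mul, div_mul_cancel₀ _ hc, sub_self]
    have h2 : polar Q (f (f v) - v) (z - (polar Q (f v) z / polar Q (f v) v) • v) = 0 := by
      rw [polar, hz _ h1, hz _ hy, hz _ (by rw [polar_add_right, hy, h1, add_zero]), sub_zero,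
        sub_zero]
    rwa [polar_sub_right, polar_smul_right, hyv, smul_zero, sub_zero] at h2
  refine hc ?_
  have := hfix (f v + v) (by rw [_root_.map_add, hffv, add_comm])
  rwa [QuadraticMap.map_add Q, hf, hv, zero_add, zero_add] at this

lemma map_map_sub_self [FiniteDimensional F V]
    (hQ : ∀ x, (∀ y, polar Q x y = 0) → x = 0) {f : End F V} (hf : ∀ v, Q (f v) = Q v)
    (h : ∀ v, Q (f v - v) = 0) (x : V) : f (f x - x) = f x - x := by
  refine sub_eq_zero.1 (hQ _ fun z => ?_)
  obtain ⟨y, rfl⟩ := surjective_of_isometry hQ hf z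
  have hxy : polar Q (f x - x) (f y - y) = 0 := by
    rw [polar, h x, h y, ← add_sub_add_comm, ← _root_.map_add, h, sub_zero, sub_zero]
  rw [polar_sub_left, polar_map_map hf, ← neg_sub, ← polar_sub_right, hxy, neg_zero]

lemma det_eq_one_of_map_map_sub_self [FiniteDimensional F V] {f : End F V}
    (h : ∀ x, f (f x - x) = f x - x) : LinearMap.det f = 1 := by
  have hnil : IsNilpotent (1 - f) := by
    refine ⟨2, LinearMap.ext fun x => ?_⟩
    have := h x
    rw [_root_.map_sub] at this
    simp only [pow_two, End.mul_apply, LinearMap.sub_apply, End.one_apply, LinearMap.zero_apply,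
      _root_.map_sub]
    rw [← neg_sub (f (f x)) (f x), this]
    abel
  have := LinearMap.eval_charpoly (1 - f) 1
  rw [hnil.charpoly_eq_X_pow_finrank, Polynomial.eval_pow, Polynomial.eval_X, one_pow, map_one,
    sub_sub_cancel] at this
  exact this.symm

lemma even_finrank_of_map_map_sub_self [FiniteDimensional F V]
    (hQ : ∀ x, (∀ y, polar Q x y = 0) → x = 0) {f : End F V}
    (hfix : ∀ v, f v = v → Q v = 0) (h : ∀ x, f (f x - x) = f x - x) :
    Even (finrank F V) := by
  have hnd : LinearMap.BilinForm.Nondegenerate Q.polarBilin :=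
    ⟨hQ, fun x hx => hQ x fun y => by rw [polar_comm]; exact hx y⟩
  have hker : ∀ x ∈ LinearMap.ker (f - 1), f x = x := fun x hx => sub_eq_zero.1 hx
  have h1 : LinearMap.ker (f - 1) ≤
      LinearMap.BilinForm.orthogonal Q.polarBilin (LinearMap.ker (f - 1)) := by
    intro x hx y hy
    change polar Q y x = 0
    rw [polar, hfix x (hker x hx), hfix y (hker y hy), hfix _ (hker _ (add_mem hy hx)), sub_zero,
      sub_zero]
  have h2 : LinearMap.range (f - 1) ≤ LinearMap.ker (f - 1) := by
    rintro _ ⟨x, rfl⟩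
    exact sub_eq_zero.2 (h x)
  have h3 := Submodule.finrank_mono h1
  rw [LinearMap.BilinForm.finrank_orthogonal hnd] at h3
  have h4 := Submodule.finrank_mono h2
  have h5 := LinearMap.finrank_range_add_finrank_ker (f - 1)
  exact ⟨finrank F (LinearMap.ker (f - 1)), by lia⟩

theorem isProdRefl_of_isometry (hF : (2 : F) ≠ 0) (n : ℕ) {V : Type*} [AddCommGroup V]
    [Module F V] [FiniteDimensional F V] (hn : finrank F V = n) {Q : QuadraticForm F V}
    (hQ : ∀ x, (∀ y, polar Q x y = 0) → x = 0) {f : End F V} (hf : ∀ v, Q (f v) = Q v) :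
    IsProdRefl Q n f := by
  induction n generalizing V with
  | zero =>
    have := finrank_zero_iff.1 hn
    exact ⟨[], le_rfl, by simp, Subsingleton.elim _ _⟩
  | succ n ih =>
    have : Nontrivial V := nontrivial_of_finrank_pos (R := F) (by lia)
    have of_fixed : ∀ g : End F V, (∀ v, Q (g v) = Q v) → ∀ v, Q v ≠ 0 → g v = v →
        IsProdRefl Q n g := by
      intro g hg v hv hgv
      refine .of_restrict_ker hF hg hv hgv fun g' hg' =>
        ih ?_ (separating_restrict_ker hF hQ hv) hg'
      have hne : Q.polarBilin v ≠ 0 := by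
        intro h0
        have h2 : polar Q v v = 0 := LinearMap.congr_fun h0 v
        rw [polar_self, nsmul_eq_mul] at h2
        exact mul_ne_zero (by exact_mod_cast hF) hv h2
      have := Dual.finrank_ker_add_one_of_ne_zero hne
      lia
    have of_residual : ∀ g : End F V, (∀ v, Q (g v) = Q v) → ∀ v, Q v ≠ 0 → Q (g v - v) ≠ 0 →
        IsProdRefl Q (n + 1) g := by
      intro g hg v hv hgv
      refine .of_reflEnd_mul hgv (of_fixed _ (fun x => ?_) v hv ?_)
      · rw [End.mul_apply, map_reflEnd hgv, hg]
      · rw [End.mul_apply, reflEnd_sub_apply (hg v) hgv]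
    have trichotomy : ∀ g : End F V, (∀ v, Q (g v) = Q v) →
        IsProdRefl Q (n + 1) g ∨ (LinearMap.det g = 1 ∧ Even (finrank F V)) := by
      intro g hg
      by_cases h1 : ∃ v, Q v ≠ 0 ∧ g v = v
      · obtain ⟨v, hv, hgv⟩ := h1
        obtain ⟨l, hl, h⟩ := of_fixed g hg v hv hgv
        exact .inl ⟨l, hl.trans n.le_succ, h⟩
      by_cases h2 : ∃ v, Q v ≠ 0 ∧ Q (g v - v) ≠ 0
      · obtain ⟨v, hv, hgv⟩ := h2
        exact .inl (of_residual g hg v hv hgv)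
      push Not at h1 h2
      have hfix : ∀ v, g v = v → Q v = 0 := fun v hgv => by_contra fun hv => h1 v hv hgv
      have h := map_map_sub_self hQ hg (map_sub_eq_zero_of_forall hF hQ hg hfix h2)
      exact .inr ⟨det_eq_one_of_map_map_sub_self h, even_finrank_of_map_map_sub_self hQ hfix h⟩
    obtain h | ⟨hdet, heven⟩ := trichotomy f hf
    · exact h
    obtain ⟨w, hw⟩ := exists_map_ne_zero hQ
    have hne : (1 : F) ≠ -1 := fun h => hF (by linear_combination h)
    have hdet' : LinearMap.det (reflEnd Q w * f) = -1 := by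
      rw [map_mul, det_reflEnd hw, hdet, mul_one]
    obtain ⟨l, hl, hlw, hprod⟩ :=
      (trichotomy (reflEnd Q w * f) fun x => by rw [End.mul_apply, map_reflEnd hw, hf]).resolve_right
        fun h => hne (h.1.symm.trans hdet')
    refine .of_reflEnd_mul hw ⟨l, ?_, hlw, hprod⟩
    have hodd : ¬ Even l.length := by
      intro he
      rw [hprod, det_prod_reflEnd l hlw, he.neg_one_pow] at hdet'
      exact hne hdet'
    rw [hn] at heven
    exact Nat.lt_succ_iff.1 (hl.lt_of_ne fun h => hodd (h ▸ heven))

lemma coe_prod_reflEnd (l : List V) :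
    ⇑(l.map (reflEnd Q)).prod = (l.map (reflAlong Q)).foldr (· ∘ ·) id := by
  induction l with
  | nil => rfl
  | cons a l ih =>
    rw [List.map_cons, List.prod_cons, End.coe_mul, ih, coe_reflEnd]
    rfl

end CartanDieudonne

/-- **Cartan–Dieudonné theorem.**
Over a field `F` of characteristic `≠ 2`, every isometry `f` of a finite-dimensional
vector space `V` with nondegenerate quadratic form `Q` is a composition of at most
`n = dim V` reflections along vectors `wᵢ` with `Q wᵢ ≠ 0`. -/
theorem cartan_dieudonne
    (F : Type*) [Field F] (hF : (2 : F) ≠ 0)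
    (V : Type*) [AddCommGroup V] [Module F V] [FiniteDimensional F V]
    (Q : QuadraticForm F V) (hQ : Q.polarBilin.Nondegenerate)
    (f : V ≃ₗ[F] V) (hf : ∀ v : V, Q (f v) = Q v) :
    ∃ (k : ℕ), k ≤ Module.finrank F V ∧
      ∃ w : Fin k → V, (∀ i, Q (w i) ≠ 0) ∧
        ⇑f = (List.ofFn fun i => reflAlong Q (w i)).foldr (· ∘ ·) id := by
  obtain ⟨l, hl, hlw, hprod⟩ := CartanDieudonne.isProdRefl_of_isometry hF _ rfl hQ.1
    (f := f.toLinearMap) hf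
  refine ⟨l.length, hl, l.get, fun i => hlw _ (l.get_mem i), ?_⟩
  have hlist : (List.ofFn fun i => reflAlong Q (l.get i)) = l.map (reflAlong Q) := by
    rw [← List.ofFn_get (l := l.map (reflAlong Q))]
    simp
  rw [hlist, ← CartanDieudonne.coe_prod_reflEnd, ← hprod]
  rfl
end

section
/- Let V be a finite-dimensional real vector space and Q a nondegenerate quadratic form on V. Then: (a) for every isometry f of (V,Q) there exists x ∈ Pin(Q) such that involute x * ι v = ι (f v) * x for all v ∈ V (surjectivity of the twisted adjoint action Pin(Q) → O(V,Q)); and (b) for x ∈ Pin(Q), one has involute x * ι v = ι v * x for all v ∈ V if and only if x = 1 or x = −1 (the kernel of the twisted adjoint action is {1, −1}). -/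
open CliffordAlgebra

variable {V : Type*} [AddCommGroup V] [Module ℝ V]

/-- The Pin group of a quadratic form: unit versors, i.e. finite products of (images of)
vectors `v` with `Q v ≠ 0` satisfying `x * reverse x = ± 1`. -/
def pinSet (Q : QuadraticForm ℝ V) : Set (CliffordAlgebra Q) :=
  {x | (∃ l : List V, (∀ v ∈ l, Q v ≠ 0) ∧ x = (l.map (ι Q)).prod) ∧
    (x * reverse x = 1 ∨ x * reverse x = -1)}

namespace ExteriorAlgebra

variable {K M : Type*} [Field K] [AddCommGroup M] [Module K M]

/-- The Euler operator `∑ i, eᵢ ∧ (eᵢ* ⌋ x)` multiplies elements of degree `k` by `k`. -/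
lemma sum_ι_mul_contractLeft_coord {I : Type*} [Fintype I] (e : Module.Basis I K M) {k : ℕ}
    {x : ExteriorAlgebra K M} (hx : x ∈ ⋀[K]^k M) :
    ∑ i, ι K (e i) * contractLeft (e.coord i) x = (k : K) • x := by
  induction hx using Submodule.pow_induction_on_left' with
  | algebraMap r => simp
  | add x y i _ _ ihx ihy => simp only [map_add, mul_add, Finset.sum_add_distrib, ihx, ihy, smul_add]
  | mem_mul m hm i x _ ih =>
    obtain ⟨a, rfl⟩ := hm
    have hterm (j : I) : ι K (e j) * contractLeft (e.coord j) (ι K a * x) =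
        e.repr a j • (ι K (e j) * x) + ι K a * (ι K (e j) * contractLeft (e.coord j) x) := by
      rw [ι, contractLeft_ι_mul, mul_sub, ← mul_assoc, ← mul_assoc,
        CliffordAlgebra.ι_mul_ι_comm (e j) a]
      simp [QuadraticMap.polar]
    have ha : ∑ j, e.repr a j • (ι K (e j) * x) = ι K a * x := by
      conv_rhs => rw [← e.sum_repr a, map_sum, Finset.sum_mul]
      simp only [map_smul, smul_mul_assoc]
    simp only [hterm, Finset.sum_add_distrib, ha, ← Finset.mul_sum, ih]
    simp [add_smul, add_comm]

lemma exists_algebraMap_eq_of_contractLeft_eq_zero [CharZero K] [FiniteDimensional K M]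
    {x : ExteriorAlgebra K M} (hx : ∀ d : Module.Dual K M, contractLeft d x = 0) :
    ∃ r : K, x = algebraMap K _ r := by
  classical
  let e := Module.finBasis K M
  let N : ExteriorAlgebra K M →ₗ[K] ExteriorAlgebra K M :=
    ∑ i, LinearMap.mulLeft K (ι K (e i)) ∘ₗ contractLeft (e.coord i)
  have hN (k : ℕ) (y : ExteriorAlgebra K M) (hy : y ∈ ⋀[K]^k M) : N y = (k : K) • y := by
    simpa [N] using sum_ι_mul_contractLeft_coord e hy
  have key (y : ExteriorAlgebra K M) (k : ℕ) :
      (DirectSum.decompose (fun i : ℕ ↦ ⋀[K]^i M) (N y) k : ExteriorAlgebra K M) =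
        (k : K) • (DirectSum.decompose (fun i : ℕ ↦ ⋀[K]^i M) y k : ExteriorAlgebra K M) := by
    induction y using DirectSum.Decomposition.inductionOn fun i : ℕ ↦ ⋀[K]^i M with
    | zero => simp
    | @homogeneous i m =>
      rw [hN i m m.2, DirectSum.decompose_smul, DirectSum.smul_apply, Submodule.coe_smul]
      by_cases h : i = k
      · subst h; rfl
      · rw [DirectSum.decompose_of_mem_ne (fun i : ℕ ↦ ⋀[K]^i M) m.2 h, smul_zero, smul_zero]
    | add y z hy hz => simp [hy, hz]
  have hNx : N x = 0 := by simp [N, hx]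
  have hzero (k : ℕ) (hk : k ≠ 0) :
      (DirectSum.decompose (fun i : ℕ ↦ ⋀[K]^i M) x k : ExteriorAlgebra K M) = 0 := by
    have h := key x k
    rw [hNx] at h
    simpa [hk] using h.symm
  have hx0 : x = DirectSum.decompose (fun i : ℕ ↦ ⋀[K]^i M) x 0 := by
    conv_lhs => rw [← DirectSum.sum_support_decompose (fun i : ℕ ↦ ⋀[K]^i M) x]
    refine Finset.sum_eq_single 0 (fun k _ hk ↦ hzero k hk) fun h ↦ ?_
    simpa using h
  have hmem : x ∈ ⋀[K]^0 M := by
    rw [hx0]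
    exact Subtype.property _
  obtain ⟨r, hr⟩ := Submodule.mem_one.1 (by simpa using hmem)
  exact ⟨r, hr.symm⟩

end ExteriorAlgebra

namespace CliffordAlgebra

section Field

variable {K M : Type*} [Field K] [AddCommGroup M] [Module K M] {Q : QuadraticForm K M}

lemma exists_algebraMap_eq_of_contractLeft_eq_zero [CharZero K] [FiniteDimensional K M]
    {x : CliffordAlgebra Q} (hx : ∀ d : Module.Dual K M, contractLeft d x = 0) :
    ∃ r : K, x = algebraMap K _ r := by
  have : Invertible (2 : K) := invertibleOfNonzero two_ne_zero
  obtain ⟨r, hr⟩ := ExteriorAlgebra.exists_algebraMap_eq_of_contractLeft_eq_zero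
    (x := equivExterior Q x) fun d ↦ by
      rw [equivExterior, changeFormEquiv_apply, ← changeForm_contractLeft, hx, map_zero]
  refine ⟨r, (equivExterior Q).injective ?_⟩
  rw [hr, equivExterior, changeFormEquiv_apply, changeForm_algebraMap]

end Field

section CommRing

variable {R M : Type*} [CommRing R] [AddCommGroup M] [Module R M] {Q : QuadraticForm R M}

/-- The twisted commutator with a vector is a contraction. -/
lemma ι_mul_sub_involute_mul_ι_s14 (v : M) (x : CliffordAlgebra Q) :
    ι Q v * x - involute x * ι Q v = contractLeft (Q.polarBilin v) x := by
  induction x using CliffordAlgebra.left_induction with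
  | algebraMap r => simp [Algebra.commutes]
  | add x y hx hy => rw [map_add, map_add, ← hx, ← hy]; noncomm_ring
  | ι_mul x m ih =>
    rw [contractLeft_ι_mul, ← ih, map_mul, involute_ι, ← mul_assoc, ι_mul_ι_comm v m,
      QuadraticMap.polarBilin_apply_apply, Algebra.smul_def]
    noncomm_ring

end CommRing

lemma exists_algebraMap_eq_of_involute_mul_ι_eq {K M : Type*} [Field K] [CharZero K]
    [AddCommGroup M] [Module K M] [FiniteDimensional K M] {Q : QuadraticForm K M}
    (hQ : Q.polarBilin.Nondegenerate) {x : CliffordAlgebra Q}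
    (hx : ∀ v, involute x * ι Q v = ι Q v * x) : ∃ r : K, x = algebraMap K _ r := by
  have hsurj : Function.Surjective Q.polarBilin :=
    (LinearMap.injective_iff_surjective_of_finrank_eq_finrank
      Subspace.dual_finrank_eq.symm).1 (LinearMap.separatingLeft_iff_ker_eq_bot.1 hQ.1 |>
        LinearMap.ker_eq_bot.1)
  refine exists_algebraMap_eq_of_contractLeft_eq_zero fun d ↦ ?_
  obtain ⟨v, rfl⟩ := hsurj d
  rw [← ι_mul_sub_involute_mul_ι_s14, hx, sub_self]

end CliffordAlgebra

/-- The reflection in the hyperplane orthogonal to `u`, provided `Q u ≠ 0`. -/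
noncomputable def hyperplaneReflection (Q : QuadraticForm ℝ V) (u : V) : V →ₗ[ℝ] V :=
  LinearMap.id - (Q u)⁻¹ • (Q.polarBilin u).smulRight u

lemma hyperplaneReflection_apply (Q : QuadraticForm ℝ V) (u v : V) :
    hyperplaneReflection Q u v = v - ((Q u)⁻¹ * QuadraticMap.polar Q u v) • u := by
  simp [hyperplaneReflection, mul_smul]

lemma QuadraticForm.map_sub_smul (Q : QuadraticForm ℝ V) (u v : V) (c : ℝ) :
    Q (v - c • u) = Q v - c * QuadraticMap.polar Q u v + c * c * Q u := by
  rw [sub_eq_add_neg, ← neg_smul, QuadraticMap.map_add Q, QuadraticMap.map_smul,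
    QuadraticMap.polar_smul_right, QuadraticMap.polar_comm]
  simp only [smul_eq_mul]
  ring

lemma map_hyperplaneReflection (Q : QuadraticForm ℝ V) {u : V} (hu : Q u ≠ 0) (v : V) :
    Q (hyperplaneReflection Q u v) = Q v := by
  rw [hyperplaneReflection_apply, QuadraticForm.map_sub_smul]
  field_simp
  ring

lemma hyperplaneReflection_of_polar_eq_zero (Q : QuadraticForm ℝ V) {u v : V}
    (h : QuadraticMap.polar Q u v = 0) : hyperplaneReflection Q u v = v := by
  simp [hyperplaneReflection_apply, h]

lemma hyperplaneReflection_self (Q : QuadraticForm ℝ V) {u : V} (hu : Q u ≠ 0) :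
    hyperplaneReflection Q u u = -u := by
  rw [hyperplaneReflection_apply, QuadraticMap.polar_self, nsmul_eq_mul, mul_comm _ (Q u),
    inv_mul_cancel_left₀ hu]
  push_cast
  module

lemma hyperplaneReflection_hyperplaneReflection (Q : QuadraticForm ℝ V) {u : V} (hu : Q u ≠ 0)
    (v : V) : hyperplaneReflection Q u (hyperplaneReflection Q u v) = v := by
  conv_lhs => rw [hyperplaneReflection_apply Q u v, map_sub, map_smul,
    hyperplaneReflection_self Q hu, hyperplaneReflection_apply]
  module

/-- Vectors of equal norm are exchanged by the reflection in their difference. -/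
lemma hyperplaneReflection_sub (Q : QuadraticForm ℝ V) {v w : V} (h : Q w = Q v)
    (hu : Q (w - v) ≠ 0) : hyperplaneReflection Q (w - v) w = v := by
  have hp : QuadraticMap.polar Q (w - v) w = Q (w - v) := by
    have h1 := QuadraticForm.map_sub_smul Q v w 1
    rw [QuadraticMap.polar_sub_left, QuadraticMap.polar_self, nsmul_eq_mul]
    rw [one_smul] at h1
    push_cast
    linarith
  rw [hyperplaneReflection_apply, hp, inv_mul_cancel₀ hu]
  module

/-- `f` is the twisted adjoint action of a product of vectors of norm `±1`. -/
def IsVersorAction (Q : QuadraticForm ℝ V) (f : V →ₗ[ℝ] V) : Prop :=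
  ∃ l : List V, (∀ v ∈ l, Q v = 1 ∨ Q v = -1) ∧
    ∀ v, involute (l.map (ι Q)).prod * ι Q v = ι Q (f v) * (l.map (ι Q)).prod

lemma neg_ι_mul_ι_eq_ι_hyperplaneReflection_mul (Q : QuadraticForm ℝ V) {u : V} (hu : Q u ≠ 0)
    (v : V) : -ι Q u * ι Q v = ι Q (hyperplaneReflection Q u v) * ι Q u := by
  rw [hyperplaneReflection_apply, map_sub, map_smul, sub_mul, smul_mul_assoc, ι_sq_scalar,
    neg_mul, ι_mul_ι_comm, Algebra.smul_def,
    ← map_mul (algebraMap ℝ (CliffordAlgebra Q)), mul_right_comm, inv_mul_cancel₀ hu, one_mul]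
  abel

lemma IsVersorAction.of_hyperplaneReflection_comp {Q : QuadraticForm ℝ V} {u : V} (hu : Q u ≠ 0)
    {f : V →ₗ[ℝ] V} (hf : IsVersorAction Q (hyperplaneReflection Q u ∘ₗ f)) :
    IsVersorAction Q f := by
  obtain ⟨l, hl, h⟩ := hf
  set c : ℝ := (√|Q u|)⁻¹
  have hc : c * c = |Q u|⁻¹ := by
    rw [← mul_inv, Real.mul_self_sqrt (abs_nonneg _)]
  refine ⟨(c • u) :: l, ?_, fun v ↦ ?_⟩
  · refine List.forall_mem_cons.2 ⟨?_, hl⟩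
    rw [QuadraticMap.map_smul, hc, smul_eq_mul]
    rcases lt_or_gt_of_ne hu with h0 | h0
    · right
      rw [abs_of_neg h0]
      field_simp
    · left
      rw [abs_of_pos h0]
      field_simp
  · rw [List.map_cons, List.prod_cons, map_mul, mul_assoc, h, map_smul, map_smul, involute_ι,
      ← mul_assoc, smul_mul_assoc, neg_ι_mul_ι_eq_ι_hyperplaneReflection_mul Q hu,
      LinearMap.comp_apply, hyperplaneReflection_hyperplaneReflection Q hu]
    simp [mul_assoc]

/-- A weak **Cartan–Dieudonné theorem** for isometries fixing all but finitely many vectors of an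
orthogonal basis. -/
lemma isVersorAction_of_fixes_basis {I : Type*} (Q : QuadraticForm ℝ V) (e : Module.Basis I ℝ V)
    (hne : ∀ i, Q (e i) ≠ 0) (ho : ∀ i j, i ≠ j → QuadraticMap.polar Q (e i) (e j) = 0)
    (s : Finset I) (f : V →ₗ[ℝ] V) (hf : ∀ v, Q (f v) = Q v) (hs : ∀ i ∉ s, f (e i) = e i) :
    IsVersorAction Q f := by
  classical
  induction s using Finset.induction_on generalizing f with
  | empty =>
    obtain rfl : f = LinearMap.id := e.ext fun i ↦ hs i (Finset.notMem_empty i)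
    exact ⟨[], by simp, by simp⟩
  | insert a s ha ih =>
    have hpolar (v w : V) : QuadraticMap.polar Q (f v) (f w) = QuadraticMap.polar Q v w := by
      simp only [QuadraticMap.polar, ← map_add, hf]
    have hva (i : I) (hi : i ∉ insert a s) : QuadraticMap.polar Q (e a) (e i) = 0 :=
      ho a i fun h ↦ hi (h ▸ Finset.mem_insert_self a s)
    have hwa (i : I) (hi : i ∉ insert a s) : QuadraticMap.polar Q (f (e a)) (e i) = 0 := by
      rw [← hva i hi, ← hpolar (e a) (e i), hs i hi]
    have hcases (g : V →ₗ[ℝ] V) (hga : g (e a) = e a) (hg : ∀ i ∉ insert a s, g (e i) = e i) :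
        ∀ i ∉ s, g (e i) = e i := fun i hi ↦ by
      by_cases h : i = a
      · rw [h, hga]
      · exact hg i (by simp [h, hi])
    by_cases hsub : Q (f (e a) - e a) = 0
    · have hadd : Q (f (e a) - -e a) ≠ 0 := by
        have h1 := QuadraticForm.map_sub_smul Q (e a) (f (e a)) 1
        have h2 := QuadraticForm.map_sub_smul Q (e a) (f (e a)) (-1)
        rw [one_smul, hsub] at h1
        rw [neg_one_smul] at h2
        have h3 := hne a
        have h4 := hf (e a)
        intro h0
        apply h3
        linarith
      refine .of_hyperplaneReflection_comp hadd (.of_hyperplaneReflection_comp (hne a)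
        (ih _ (fun v ↦ ?_) (hcases _ ?_ fun i hi ↦ ?_)))
      · simp only [LinearMap.comp_apply, map_hyperplaneReflection Q (hne a),
          map_hyperplaneReflection Q hadd, hf]
      · rw [LinearMap.comp_apply, LinearMap.comp_apply,
          hyperplaneReflection_sub Q (by rw [QuadraticMap.map_neg, hf]) hadd, map_neg,
          hyperplaneReflection_self Q (hne a), neg_neg]
      · rw [LinearMap.comp_apply, LinearMap.comp_apply, hs i hi,
          hyperplaneReflection_of_polar_eq_zero Q (u := f (e a) - -e a),
          hyperplaneReflection_of_polar_eq_zero Q (hva i hi)]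
        rw [QuadraticMap.polar_sub_left, QuadraticMap.polar_neg_left, hwa i hi, hva i hi]
        simp
    · refine .of_hyperplaneReflection_comp hsub
        (ih _ (fun v ↦ ?_) (hcases _ ?_ fun i hi ↦ ?_))
      · rw [LinearMap.comp_apply, map_hyperplaneReflection Q hsub, hf]
      · rw [LinearMap.comp_apply, hyperplaneReflection_sub Q (hf _) hsub]
      · rw [LinearMap.comp_apply, hs i hi, hyperplaneReflection_of_polar_eq_zero]
        rw [QuadraticMap.polar_sub_left, hwa i hi, hva i hi, sub_zero]

/-- Every isometry of a nondegenerate real quadratic form is a product of reflections. -/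
lemma isVersorAction_of_isometry [FiniteDimensional ℝ V] (Q : QuadraticForm ℝ V)
    (hQ : Q.polarBilin.Nondegenerate) (f : V →ₗ[ℝ] V) (hf : ∀ v, Q (f v) = Q v) :
    IsVersorAction Q f := by
  obtain ⟨e, he⟩ := LinearMap.BilinForm.exists_orthogonal_basis (B := Q.polarBilin)
    ⟨fun v w ↦ QuadraticMap.polar_comm Q v w⟩
  refine isVersorAction_of_fixes_basis Q e (fun i h ↦ ?_) (fun i j hij ↦ he hij) Finset.univ f hf
    (by simp)
  have : Nontrivial V := ⟨e i, 0, e.ne_zero i⟩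
  refine LinearMap.IsOrthoᵢ.not_isOrtho_basis_self_of_separatingLeft he hQ.1 i ?_
  simp [QuadraticMap.polar_self, h]

lemma prod_map_ι_mul_reverse (Q : QuadraticForm ℝ V) (l : List V)
    (hl : ∀ v ∈ l, Q v = 1 ∨ Q v = -1) :
    (l.map (ι Q)).prod * reverse (l.map (ι Q)).prod = 1 ∨
      (l.map (ι Q)).prod * reverse (l.map (ι Q)).prod = -1 := by
  induction l with
  | nil => simp
  | cons a l ih =>
    obtain ⟨ha, hl⟩ := List.forall_mem_cons.1 hl
    have hassoc : (List.map (ι Q) (a :: l)).prod * reverse (List.map (ι Q) (a :: l)).prod =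
        ι Q a * ((l.map (ι Q)).prod * reverse (l.map (ι Q)).prod) * ι Q a := by
      simp [mul_assoc]
    rw [hassoc]
    rcases ih hl with h | h <;> rcases ha with ha | ha <;> simp [h, ha]

lemma eq_one_or_eq_neg_one_of_algebraMap {Q : QuadraticForm ℝ V} {x : CliffordAlgebra Q} {r : ℝ}
    (hr : x = algebraMap ℝ _ r) (hx : x * reverse x = 1 ∨ x * reverse x = -1) :
    x = 1 ∨ x = -1 := by
  have : Invertible (2 : ℝ) := invertibleOfNonzero two_ne_zero
  have hinj : Function.Injective (algebraMap ℝ (CliffordAlgebra Q)) :=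
    FaithfulSMul.algebraMap_injective _ _
  subst hr
  rw [reverse.commutes, ← map_mul] at hx
  rcases hx with h | h
  · have h1 : r * r = 1 := hinj (by rw [h, map_one])
    rcases mul_self_eq_one_iff.1 h1 with rfl | rfl <;> simp
  · have h1 : r * r = -1 := hinj (by rw [h, map_neg, map_one])
    nlinarith [mul_self_nonneg r]

/-- **The twisted adjoint action `Pin(Q) → O(V,Q)` is surjective with kernel `{±1}`.**
(a) every isometry `f` of `(V, Q)` is represented by some `x ∈ Pin(Q)` via
`involute x * ι v = ι (f v) * x`; (b) `x ∈ Pin(Q)` acts trivially, i.e.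
`involute x * ι v = ι v * x` for all `v`, if and only if `x = 1` or `x = -1`. -/
theorem pin_twisted_adjoint_surjective_kernel
    [FiniteDimensional ℝ V] (Q : QuadraticForm ℝ V) (hQ : Q.polarBilin.Nondegenerate) :
    (∀ f : V ≃ₗ[ℝ] V, (∀ v : V, Q (f v) = Q v) →
      ∃ x ∈ pinSet Q, ∀ v : V, involute x * ι Q v = ι Q (f v) * x) ∧
    (∀ x ∈ pinSet Q,
      ((∀ v : V, involute x * ι Q v = ι Q v * x) ↔ (x = 1 ∨ x = -1))) := by
  refine ⟨fun f hf ↦ ?_, fun x hx ↦ ⟨fun h ↦ ?_, ?_⟩⟩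
  · obtain ⟨l, hl, h⟩ := isVersorAction_of_isometry Q hQ f.toLinearMap hf
    refine ⟨_, ⟨⟨l, fun v hv ↦ ?_, rfl⟩, prod_map_ι_mul_reverse Q l hl⟩, h⟩
    rcases hl v hv with h | h <;> norm_num [h]
  · obtain ⟨r, hr⟩ := exists_algebraMap_eq_of_involute_mul_ι_eq hQ h
    exact eq_one_or_eq_neg_one_of_algebraMap hr hx.2
  · rintro (rfl | rfl) v <;> simp
end

section
/- (Uniqueness of the determinant) Let n ≥ 1 and suppose d : Matrix (Fin n) (Fin n) ℝ → ℝ is continuous and satisfies d(A * B) = d(A) * d(B) for all A, B. Then exactly one of the following holds: d is identically 0; d is identically 1; there exists α > 0 with d(A) = |det A|^α for all A; or there exists α > 0 with d(A) = sign(det A) · |det A|^α for all A. -/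
section

variable {n K R : Type*} [Fintype n] [DecidableEq n] [Field K] [CommMonoid R]

/-- A multiplicative map from matrices to a commutative monoid is trivial on transvections. -/
theorem MonoidHom.map_transvection_eq_one [NeZero (2 : K)] (f : Matrix n n K →* R)
    {i j : n} (hij : i ≠ j) (c : K) : f (Matrix.transvection i j c) = 1 := by
  have hD : IsUnit (f (Matrix.diagonal (Function.update (1 : n → K) i 2))) := by
    apply IsUnit.map
    rw [Matrix.isUnit_diagonal, Pi.isUnit_iff]
    intro k
    by_cases hk : k = i
    · subst hk; simp [two_ne_zero]
    · simp [hk]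
  have hT : IsUnit (f (Matrix.transvection i j c)) := by
    apply IsUnit.map
    rw [Matrix.isUnit_iff_isUnit_det, Matrix.det_transvection_of_ne _ _ hij]
    exact isUnit_one
  have hconj : Matrix.diagonal (Function.update (1 : n → K) i 2) * Matrix.transvection i j c =
      Matrix.transvection i j (c + c) * Matrix.diagonal (Function.update (1 : n → K) i 2) := by
    ext a b
    simp only [Matrix.diagonal_mul, Matrix.mul_diagonal, Matrix.transvection, Matrix.add_apply,
      Matrix.one_apply, Matrix.single_apply, Function.update_apply, Pi.one_apply]
    grind
  have h := congrArg f hconj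
  rw [map_mul, map_mul, mul_comm, hD.mul_left_inj,
    ← Matrix.transvection_mul_transvection_same _ _ hij, map_mul] at h
  exact hT.mul_left_cancel (by rw [← h, mul_one])

/-- A multiplicative map from matrices to a commutative monoid is invariant under simultaneous
permutation of rows and columns. -/
theorem MonoidHom.map_matrix_submatrix_perm (f : Matrix n n K →* R) (σ : Equiv.Perm n)
    (A : Matrix n n K) : f (A.submatrix σ σ) = f A := by
  have h : A.submatrix σ σ = σ.permMatrix K * A * (σ⁻¹).permMatrix K := by
    rw [Equiv.Perm.permMatrix, Equiv.Perm.permMatrix, PEquiv.toMatrix_toPEquiv_mul,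
      PEquiv.mul_toMatrix_toPEquiv]
    ext; simp [Equiv.Perm.inv_def]
  have hσ : (σ⁻¹).permMatrix K * σ.permMatrix K = 1 := by
    rw [← Matrix.permMatrix_mul, mul_inv_cancel, Matrix.permMatrix_one]
  rw [h, map_mul, map_mul, mul_comm, ← mul_assoc, ← map_mul, hσ, map_one, one_mul]

/-- A multiplicative map from matrices to a commutative monoid factors through the determinant. -/
theorem MonoidHom.map_matrix_eq_map_diagonal_det [NeZero (2 : K)] (f : Matrix n n K →* R) (i : n)
    (A : Matrix n n K) : f A = f (Matrix.diagonal (Pi.mulSingle i A.det)) := by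
  let φ : K →* R := f.comp
    ((Matrix.diagonalRingHom n K : (n → K) →* Matrix n n K).comp (MonoidHom.mulSingle (fun _ : n => K) i))
  change f A = φ A.det
  induction A using Matrix.diagonal_transvection_induction with
  | hdiag D _ =>
    have hswap (j : n) : f (Matrix.diagonal (Pi.mulSingle j (D j))) = φ (D j) := by
      change _ = f (Matrix.diagonal (Pi.mulSingle i (D j)))
      rw [← f.map_matrix_submatrix_perm (Equiv.swap i j) (Matrix.diagonal (Pi.mulSingle j (D j))),
        Matrix.submatrix_diagonal_equiv]
      congr 2
      ext k
      simp only [Function.comp_apply, Pi.mulSingle_apply, Equiv.swap_apply_def]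
      grind
    rw [Matrix.det_diagonal, map_prod]
    simp_rw [← hswap]
    change _ = ∏ j, (f.comp (Matrix.diagonalRingHom n K : (n → K) →* Matrix n n K)) _
    rw [← map_prod, Finset.univ_prod_mulSingle]
    rfl
  | htransvec t =>
    rw [t.det, map_one]
    exact f.map_transvection_eq_one t.hij t.c
  | hmul A B hA hB => rw [map_mul, hA, hB, Matrix.det_mul, map_mul]

end

/-- A continuous multiplicative map `ℝ → ℝ` vanishing at zero is a power function on the positive
reals. -/
theorem MonoidHom.exists_eq_rpow_of_continuous (φ : ℝ →* ℝ) (hφ : Continuous φ) (h0 : φ 0 = 0) :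
    ∃ α : ℝ, 0 < α ∧ ∀ x, 0 < x → φ x = x ^ α := by
  have hpos (t : ℝ) : 0 < φ (Real.exp t) := by
    have hne : φ (Real.exp (t / 2)) ≠ 0 := ((Real.exp_ne_zero _).isUnit.map φ).ne_zero
    have : φ (Real.exp t) = φ (Real.exp (t / 2)) * φ (Real.exp (t / 2)) := by
      rw [← map_mul, ← Real.exp_add, add_halves]
    rw [this]
    exact mul_self_pos.2 hne
  let g : ℝ →+ ℝ :=
    { toFun := fun t => Real.log (φ (Real.exp t))
      map_zero' := by simp
      map_add' := fun s t => by
        rw [Real.exp_add, map_mul, Real.log_mul (hpos s).ne' (hpos t).ne'] }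
  have hg : Continuous g :=
    (hφ.comp Real.continuous_exp).log fun t => (hpos t).ne'
  have hlin (t : ℝ) : φ (Real.exp t) = Real.exp (t * g 1) := by
    have h : g t = t * g 1 := by simpa using map_real_smul g hg t 1
    rw [← h]
    exact (Real.exp_log (hpos t)).symm
  refine ⟨g 1, ?_, fun x hx => ?_⟩
  · by_contra! hα
    have htend : Filter.Tendsto (fun t => φ (Real.exp t)) Filter.atBot (nhds 0) := by
      simpa [h0, Function.comp_def] using (hφ.tendsto 0).comp Real.tendsto_exp_atBot
    have hle : (1 : ℝ) ≤ 0 := by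
      refine ge_of_tendsto htend ?_
      filter_upwards [Filter.eventually_le_atBot 0] with t ht
      rw [hlin]
      exact Real.one_le_exp (mul_nonneg_of_nonpos_of_nonpos ht hα)
    linarith
  · rw [Real.rpow_def_of_pos hx, ← hlin, Real.exp_log hx]

/-- A continuous multiplicative map `ℝ → ℝ` vanishing at zero is a power of the absolute value,
possibly multiplied by the sign. -/
theorem MonoidHom.eq_abs_rpow_or_eq_sign_mul_abs_rpow (φ : ℝ →* ℝ) (hφ : Continuous φ)
    (h0 : φ 0 = 0) :
    ∃ α : ℝ, 0 < α ∧ ((∀ x, φ x = |x| ^ α) ∨ ∀ x, φ x = Real.sign x * |x| ^ α) := by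
  obtain ⟨α, hα, hpow⟩ := φ.exists_eq_rpow_of_continuous hφ h0
  have hneg (x : ℝ) (hx : x < 0) : φ x = φ (-1) * |x| ^ α := by
    rw [← hpow _ (abs_pos.2 hx.ne), ← map_mul, abs_of_neg hx]
    simp
  have hsq : φ (-1) = 1 ∨ φ (-1) = -1 := by
    rw [← mul_self_eq_one_iff, ← map_mul]
    simp
  refine ⟨α, hα, hsq.imp (fun h x => ?_) (fun h x => ?_)⟩ <;>
    rcases lt_trichotomy x 0 with hx | rfl | hx
  · rw [hneg x hx, h, one_mul]
  · simp [h0, hα.ne']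
  · rw [hpow x hx, abs_of_pos hx]
  · rw [hneg x hx, h, Real.sign_of_neg hx]
  · simp [h0]
  · rw [hpow x hx, abs_of_pos hx, Real.sign_of_pos hx, one_mul]

/-- **Uniqueness of the determinant.**
If `d : ℝ^{n×n} → ℝ` (with `n ≥ 1`) is continuous and multiplicative,
`d (A * B) = d A * d B`, then `d` is identically `0`, identically `1`,
`|det|^α`, or `sign ∘ det · |det|^α` for some `α > 0`. -/
theorem determinant_uniqueness (n : ℕ) (hn : 1 ≤ n)
    (d : Matrix (Fin n) (Fin n) ℝ → ℝ) (hcont : Continuous d)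
    (hmul : ∀ A B : Matrix (Fin n) (Fin n) ℝ, d (A * B) = d A * d B) :
    (∀ A, d A = 0) ∨ (∀ A, d A = 1) ∨
    (∃ α : ℝ, 0 < α ∧ ∀ A, d A = |A.det| ^ α) ∨
    (∃ α : ℝ, 0 < α ∧ ∀ A, d A = Real.sign A.det * |A.det| ^ α) := by
  by_cases hd0 : d 0 = 0
  swap
  · refine Or.inr (Or.inl fun A => mul_left_cancel₀ hd0 ?_)
    rw [← hmul, zero_mul, mul_one]
  by_cases hd1 : d 1 = 1
  swap
  · refine Or.inl fun A => ?_
    have h : d 1 * d A = d A := by rw [← hmul, one_mul]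
    by_contra hA
    exact hd1 ((mul_eq_right₀ hA).1 h)
  have : NeZero n := ⟨by omega⟩
  let f : Matrix (Fin n) (Fin n) ℝ →* ℝ := { toFun := d, map_one' := hd1, map_mul' := hmul }
  let φ : ℝ →* ℝ := f.comp ((Matrix.diagonalRingHom (Fin n) ℝ : (Fin n → ℝ) →*
    Matrix (Fin n) (Fin n) ℝ).comp (MonoidHom.mulSingle (fun _ : Fin n => ℝ) 0))
  have hfac (A : Matrix (Fin n) (Fin n) ℝ) : d A = φ A.det := f.map_matrix_eq_map_diagonal_det 0 A
  have hφ : Continuous φ := hcont.comp (continuous_mulSingle 0).matrix_diagonal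
  have h0 : φ 0 = 0 := by
    have h := hfac 0
    rwa [Matrix.det_zero, hd0, eq_comm] at h
  obtain ⟨α, hα, h | h⟩ := φ.eq_abs_rpow_or_eq_sign_mul_abs_rpow hφ h0
  · exact Or.inr (Or.inr (Or.inl ⟨α, hα, fun A => by rw [hfac, h]⟩))
  · exact Or.inr (Or.inr (Or.inr ⟨α, hα, fun A => by rw [hfac, h]⟩))
end

section
/- (Basis minor theorem) Let R be a commutative ring, and A : Matrix (Fin n) (Fin m) R with k ≤ n and k ≤ m. Let d be the determinant of the top-left k × k submatrix of A (rows and columns indexed 0,…,k−1), and assume d ≠ 0 and that every (k+1) × (k+1) submatrix of A (obtained by selecting any k+1 rows and any k+1 columns, via strictly monotone index maps) has determinant zero. Then for every column index j, the vector d • (column j of A) lies in the R-submodule of (Fin n → R) spanned by the first k columns of A. -/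
theorem Fin.strictMono_snoc_castLE {n k : ℕ} (hkn : k ≤ n) {i : Fin n} (hi : k ≤ (i : ℕ)) :
    StrictMono (Fin.snoc (α := fun _ => Fin n) (Fin.castLE hkn) i : Fin (k + 1) → Fin n) := by
  intro a b hab
  induction b using Fin.lastCases with
  | last =>
    induction a using Fin.lastCases with
    | last => exact absurd hab (lt_irrefl _)
    | cast a =>
      simp only [Fin.snoc_castSucc, Fin.snoc_last, Fin.lt_def, Fin.val_castLE]
      exact a.isLt.trans_le hi
  | cast b =>
    induction a using Fin.lastCases with
    | last => exact absurd hab (Fin.castSucc_lt_last b).not_gt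
    | cast a =>
      simp only [Fin.snoc_castSucc]
      exact Fin.strictMono_castLE hkn (Fin.castSucc_lt_castSucc_iff.mp hab)

/-- If every bordering of the matrix `fun a b => A (r a) (c b)` by a row of `A` and the column `j`
has zero determinant, then its determinant times column `j` is in the span of the columns `c b`. -/
theorem Matrix.det_smul_col_mem_span_of_bordered_det_eq_zero {R ι κ : Type*} [CommRing R] {k : ℕ}
    (A : Matrix ι κ R) (r : Fin k → ι) (c : Fin k → κ) (j : κ)
    (h : ∀ i, (A.submatrix (Fin.snoc (α := fun _ => ι) r i)
      (Fin.snoc (α := fun _ => κ) c j)).det = 0) :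
    ((A.submatrix r c).det • fun i => A i j) ∈
      Submodule.span R (Set.range fun b : Fin k => fun i => A i (c b)) := by
  have key : ((A.submatrix r c).det • fun i => A i j) =
      -∑ b : Fin k, ((-1) ^ (k + (b : ℕ)) *
        (A.submatrix r (Fin.snoc (α := fun _ => κ) c j ∘ b.castSucc.succAbove)).det) •
          fun i => A i (c b) := by
    funext i
    have hi := h i
    rw [Matrix.det_succ_row _ (Fin.last k), Fin.sum_univ_castSucc] at hi
    have hr : Fin.snoc (α := fun _ => ι) r i ∘ Fin.castSucc = r := by
      funext a; simp
    have hc : Fin.snoc (α := fun _ => κ) c j ∘ Fin.castSucc = c := by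
      funext a; simp
    simp only [Matrix.submatrix_submatrix, Fin.succAbove_last, hr, hc, Matrix.submatrix_apply,
      Fin.snoc_last, Fin.snoc_castSucc, Fin.val_last, Fin.val_castSucc,
      Even.neg_one_pow ⟨k, rfl⟩, one_mul] at hi
    simp only [Pi.smul_apply, Pi.neg_apply, Finset.sum_apply, smul_eq_mul]
    rw [eq_neg_iff_add_eq_zero, add_comm, ← hi]
    congr 1
    · exact Finset.sum_congr rfl fun b _ => by ring
    · ring
  rw [key]
  exact neg_mem (sum_mem fun b _ => Submodule.smul_mem _ _ (Submodule.subset_span ⟨b, rfl⟩))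

/-- **Basis minor theorem** (over an arbitrary commutative ring).
Let `A` be an `n × m` matrix over a commutative ring `R` and `k ≤ n`, `k ≤ m`. If the
determinant `d` of the top-left `k × k` submatrix is nonzero and every
`(k+1) × (k+1)` submatrix of `A` (selected by strictly monotone row and column maps) has
determinant zero, then for every column index `j`, `d` times the `j`-th column of `A`
lies in the span of the first `k` columns of `A`. -/
theorem basis_minor (R : Type*) [CommRing R] (n m k : ℕ) (hkn : k ≤ n) (hkm : k ≤ m)
    (A : Matrix (Fin n) (Fin m) R)
    (hd : (A.submatrix (Fin.castLE hkn) (Fin.castLE hkm)).det ≠ 0)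
    (hminor : ∀ (I : Fin (k + 1) → Fin n) (J : Fin (k + 1) → Fin m),
      StrictMono I → StrictMono J → (A.submatrix I J).det = 0)
    (j : Fin m) :
    ((A.submatrix (Fin.castLE hkn) (Fin.castLE hkm)).det • fun i : Fin n => A i j) ∈
      Submodule.span R
        (Set.range fun c : Fin k => fun i : Fin n => A i (Fin.castLE hkm c)) := by
  rcases lt_or_ge (j : ℕ) k with hj | hj
  · exact Submodule.smul_mem _ _ (Submodule.subset_span ⟨⟨j, hj⟩, rfl⟩)
  · refine A.det_smul_col_mem_span_of_bordered_det_eq_zero _ _ j fun i => ?_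
    rcases lt_or_ge (i : ℕ) k with hi | hi
    · refine Matrix.det_zero_of_row_eq (Fin.castSucc_lt_last ⟨i, hi⟩).ne ?_
      funext b
      simp only [Matrix.submatrix_apply, Fin.snoc_castSucc, Fin.snoc_last]
      rfl
    · exact hminor _ _ (Fin.strictMono_snoc_castLE hkn hi) (Fin.strictMono_snoc_castLE hkm hj)
end
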